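/- arXiv:2403.19630 — 2 statements merged into one kernel-verified Lean document; each statement's English description precedes it below -/
import Mathlib

section
/- Let m, n, ℓ be integers with m ≥ 6, n ≥ m, 0 ≤ ℓ ≤ m, and Δ = 4mn − ℓ². Then the modulus of (2π)^{−1}·d(m)·(4m/Δ)^{25/4}·Σ_{γ=1}^∞ Σ_{ℓ̃=−m+1}^{m} Σ_{g ≡ ℓ̃ (mod 2m), −mγ < g ≤ mγ} Kl(Δ/(4m), −1 − g²/(4m); γ, ψ)_{ℓℓ̃}·γ^{−2}·∫_{−1/√m}^{1/√m} f_{γ,g,m}(x)·(1 − mx²)^{25/4}·I_{25/2}(2π√(Δ(1 − mx²))/(γ√m)) dx is strictly less than 0.015·C_pos(Δ, m), where C_pos(Δ, m) = 2π·(m+2)·(2m)^{−1/2}·((4m+m²)/Δ)^{23/4}·I_{23/2}(π√(Δ(4m+m²))/m). -/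
open Real

noncomputable def besselI (ν x : ℝ) : ℝ :=
  ∑' k : ℕ, (x / 2) ^ (2 * (k : ℝ) + ν) / ((k.factorial : ℝ) * Real.Gamma ((k : ℝ) + ν + 1))

/-- The multiplier system `ψ(γ, δ)_{ℓ̃ℓ}` of the index-`m` theta functions, where
`α` is the inverse of `δ` modulo `γ` (taken in `[0, γ)`). -/
noncomputable def psiMult (m γ : ℕ) (δ : ℤ) (ℓt ℓ : ℤ) : ℂ :=
  (((2 * m * γ : ℕ) : ℂ) * Complex.I) ^ (-(1 / 2 : ℂ)) *
    ∑ T ∈ Finset.range γ,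
      Complex.exp (2 * (Real.pi : ℂ) * Complex.I *
        ((((((δ : ZMod γ)⁻¹).val : ℕ) : ℂ) * ((ℓt : ℂ) - 2 * m * T) ^ 2) / (4 * m * γ)
          - ((ℓ : ℂ) * ((ℓt : ℂ) - 2 * m * T)) / (2 * m * γ)
          + ((δ : ℂ) * (ℓ : ℂ) ^ 2) / (4 * m * γ)))

/-- The generalized Kloosterman sum `Kl(A, B; γ, ψ)_{ℓℓ̃}`: the sum runs over
`δ = -j` with `0 ≤ j < γ` and `gcd(j, γ) = 1`, and `α(δ, γ)` is the inverse of `δ` mod `γ`. -/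
noncomputable def Kl (m : ℕ) (A B : ℚ) (γ : ℕ) (ℓ ℓt : ℤ) : ℂ :=
  ∑ j ∈ (Finset.range γ).filter fun j => Nat.gcd j γ = 1,
    Complex.exp (2 * (Real.pi : ℂ) * Complex.I *
      (((((-(j : ℤ) : ZMod γ)⁻¹).val : ℕ) : ℂ) * (B : ℂ) / γ + ((-(j : ℤ) : ℤ) : ℂ) * (A : ℂ) / γ)) *
    psiMult m γ (-(j : ℤ)) ℓt ℓ

/-- `d n`: the coefficient of `q^(n+1)` in `∏ (1 - q^j)^{-24}`. -/
def dcoef (n : ℤ) : ℤ :=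
  if 0 ≤ n + 1 then
    ∑ v ∈ Finset.Nat.antidiagonalTuple 24 (n + 1).toNat,
      ∏ i, (Fintype.card (Nat.Partition (v i)) : ℤ)
  else 0

/-- The function `f_{γ,g,m}(x)`. -/
noncomputable def fFun (m γ : ℕ) (g : ℤ) (x : ℝ) : ℂ :=
  if g % (2 * (m : ℤ) * γ) = 0 then
    ((Real.pi ^ 2 / (Real.sinh (Real.pi * x / γ)) ^ 2 - (γ : ℝ) ^ 2 / x ^ 2 : ℝ) : ℂ)
  else
    (Real.pi : ℂ) ^ 2 /
      (Complex.sinh ((Real.pi : ℂ) * x / γ - (Real.pi : ℂ) * Complex.I * g / (2 * m * γ))) ^ 2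

/-- The inner integral `∫_{-1/√m}^{1/√m} f_{γ,g,m}(x) (1-mx²)^{25/4}
    I_{25/2}(2π√(Δ(1-mx²))/(γ√m)) dx`. -/
noncomputable def innerInt (m γ : ℕ) (g : ℤ) (Δ : ℤ) : ℂ :=
  ∫ x in (-(1 : ℝ) / Real.sqrt m)..(1 / Real.sqrt m),
    fFun m γ g x * (((1 - m * x ^ 2 : ℝ) ^ ((25 : ℝ) / 4) : ℝ) : ℂ) *
      (besselI (25 / 2)
        (2 * Real.pi * Real.sqrt ((Δ : ℝ) * (1 - m * x ^ 2)) / (γ * Real.sqrt m)) : ℝ)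

/-- The inner (finite) double sum over `ℓ̃` and `g` of the triple series,
for a given `γ ≥ 1`. -/
noncomputable def tripleTerm (m : ℕ) (ℓ : ℤ) (Δ : ℤ) (γ : ℕ) : ℂ :=
  ∑ ℓt ∈ Finset.Icc (-(m : ℤ) + 1) (m : ℤ),
    ∑ g ∈ (Finset.Ioc (-(m : ℤ) * γ) ((m : ℤ) * γ)).filter
        (fun g => g % (2 * (m : ℤ)) = ℓt % (2 * (m : ℤ))),
      Kl m ((Δ : ℚ) / (4 * m)) (-1 - (g : ℚ) ^ 2 / (4 * m)) γ ℓ ℓt *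
        ((γ : ℂ) ^ 2)⁻¹ * innerInt m γ g Δ

/-- `C_pos(Δ, m) = 2π(m+2)(2m)^{-1/2}((4m+m²)/Δ)^{23/4} I_{23/2}(π√(Δ(4m+m²))/m)`. -/
noncomputable def Cpos (m : ℕ) (Δ : ℤ) : ℝ :=
  2 * Real.pi * ((m : ℝ) + 2) * (2 * (m : ℝ)) ^ (-(1 / 2 : ℝ)) *
    ((4 * (m : ℝ) + (m : ℝ) ^ 2) / (Δ : ℝ)) ^ ((23 : ℝ) / 4) *
    besselI (23 / 2) (Real.pi * Real.sqrt ((Δ : ℝ) * (4 * (m : ℝ) + (m : ℝ) ^ 2)) / m)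

/-- The entire function `∑ t^k / (k! Γ(k + ν + 1))`, so that
`besselI ν x = (x / 2)^ν * besselSeries ν (x² / 4)`. -/
noncomputable def besselSeries (ν t : ℝ) : ℝ :=
  ∑' k : ℕ, t ^ k / ((k.factorial : ℝ) * Real.Gamma ((k : ℝ) + ν + 1))

lemma one_le_Gamma_natCast_add {ν : ℝ} (hν : 1 ≤ ν) (k : ℕ) :
    1 ≤ Real.Gamma ((k : ℝ) + ν + 1) := by
  have hk : (0 : ℝ) ≤ k := k.cast_nonneg
  have h := Real.Gamma_strictMonoOn_Ici.monotoneOn (a := 2) (b := (k : ℝ) + ν + 1)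
    (by simp) (by simp only [Set.mem_Ici]; linarith) (by linarith)
  rwa [Real.Gamma_two] at h

lemma besselSeries_term_nonneg {ν t : ℝ} (hν : 1 ≤ ν) (ht : 0 ≤ t) (k : ℕ) :
    0 ≤ t ^ k / ((k.factorial : ℝ) * Real.Gamma ((k : ℝ) + ν + 1)) := by
  have := one_le_Gamma_natCast_add hν k
  positivity

lemma besselSeries_term_le {ν t : ℝ} (hν : 1 ≤ ν) (ht : 0 ≤ t) (k : ℕ) :
    t ^ k / ((k.factorial : ℝ) * Real.Gamma ((k : ℝ) + ν + 1)) ≤ t ^ k / k.factorial := by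
  have hk : (0 : ℝ) < k.factorial := by positivity
  gcongr
  exact le_mul_of_one_le_right hk.le (one_le_Gamma_natCast_add hν k)

lemma summable_besselSeries {ν t : ℝ} (hν : 1 ≤ ν) (ht : 0 ≤ t) :
    Summable fun k : ℕ => t ^ k / ((k.factorial : ℝ) * Real.Gamma ((k : ℝ) + ν + 1)) :=
  (Real.summable_pow_div_factorial t).of_nonneg_of_le
    (besselSeries_term_nonneg hν ht) (besselSeries_term_le hν ht)

lemma summable_natCast_mul_besselSeries {ν t : ℝ} (hν : 1 ≤ ν) (ht : 0 ≤ t) :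
    Summable fun k : ℕ =>
      (k : ℝ) * (t ^ k / ((k.factorial : ℝ) * Real.Gamma ((k : ℝ) + ν + 1))) := by
  refine (Real.summable_pow_div_factorial (2 * t)).of_nonneg_of_le
    (fun k => mul_nonneg k.cast_nonneg (besselSeries_term_nonneg hν ht k)) fun k => ?_
  have h2 : (k : ℝ) ≤ 2 ^ k := by exact_mod_cast Nat.lt_two_pow_self.le
  calc (k : ℝ) * (t ^ k / ((k.factorial : ℝ) * Real.Gamma ((k : ℝ) + ν + 1)))
      ≤ 2 ^ k * (t ^ k / k.factorial) :=
        mul_le_mul h2 (besselSeries_term_le hν ht k) (besselSeries_term_nonneg hν ht k)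
          (by positivity)
    _ = (2 * t) ^ k / k.factorial := by rw [mul_pow]; ring

lemma besselSeries_pos {ν t : ℝ} (hν : 1 ≤ ν) (ht : 0 ≤ t) : 0 < besselSeries ν t := by
  refine (summable_besselSeries hν ht).tsum_pos (besselSeries_term_nonneg hν ht) 0 ?_
  have := one_le_Gamma_natCast_add hν 0
  simp only [pow_zero, Nat.factorial_zero, Nat.cast_one, one_mul]
  positivity

lemma besselSeries_mono {ν s t : ℝ} (hν : 1 ≤ ν) (hs : 0 ≤ s) (hst : s ≤ t) :
    besselSeries ν s ≤ besselSeries ν t := by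
  refine (summable_besselSeries hν hs).tsum_le_tsum (fun k => ?_)
    (summable_besselSeries hν (hs.trans hst))
  have := one_le_Gamma_natCast_add hν k
  gcongr

lemma besselI_eq_rpow_mul_besselSeries {ν x : ℝ} (hν : 0 ≤ ν) (hx : 0 ≤ x) :
    besselI ν x = (x / 2) ^ ν * besselSeries ν (x ^ 2 / 4) := by
  rw [besselI, besselSeries, ← tsum_mul_left]
  refine tsum_congr fun k => ?_
  rw [Real.rpow_add_of_nonneg (by positivity) (by positivity) hν]
  have : (x / 2) ^ (2 * (k : ℝ)) = (x ^ 2 / 4) ^ k := by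
    rw [show (2 * (k : ℝ)) = ((2 * k : ℕ) : ℝ) by push_cast; ring, Real.rpow_natCast, pow_mul]
    congr 1; ring
  rw [this]; ring

lemma besselI_nonneg {ν x : ℝ} (hν : 1 ≤ ν) (hx : 0 ≤ x) : 0 ≤ besselI ν x := by
  rw [besselI_eq_rpow_mul_besselSeries (by linarith) hx]
  have := besselSeries_pos hν (t := x ^ 2 / 4) (by positivity)
  positivity

lemma besselI_mul_le {ν x r : ℝ} (hν : 1 ≤ ν) (hx : 0 ≤ x) (hr : 0 ≤ r) (hr1 : r ≤ 1) :
    besselI ν (x * r) ≤ r ^ ν * besselI ν x := by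
  rw [besselI_eq_rpow_mul_besselSeries (by linarith) hx,
    besselI_eq_rpow_mul_besselSeries (by linarith) (by positivity),
    show x * r / 2 = r * (x / 2) by ring, Real.mul_rpow hr (by positivity), mul_assoc]
  gcongr
  refine besselSeries_mono hν (by positivity) ?_
  rw [mul_pow]
  have : r ^ 2 ≤ 1 := pow_le_one₀ hr hr1
  nlinarith [sq_nonneg x]

/-- The logarithmic derivative of `besselSeries` at `s` is at least `K / s`. -/
lemma tsum_sub_mul_besselSeries_nonneg {ν s : ℝ} (hν : 1 ≤ ν) (hs : 0 ≤ s) (K : ℕ)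
    (hK : ((K : ℝ) + 1) * (K + 1 + ν) ≤ s) :
    0 ≤ ∑' k : ℕ, ((k : ℝ) - K) *
      (s ^ k / ((k.factorial : ℝ) * Real.Gamma ((k : ℝ) + ν + 1))) := by
  set b : ℕ → ℝ := fun k => s ^ k / ((k.factorial : ℝ) * Real.Gamma ((k : ℝ) + ν + 1)) with hb
  have hb0 : ∀ k, 0 ≤ b k := besselSeries_term_nonneg hν hs
  have hsum : Summable b := summable_besselSeries hν hs
  have hsumk : Summable fun k : ℕ => (k : ℝ) * b k := summable_natCast_mul_besselSeries hν hs
  have hrec : ∀ k : ℕ, b (k + 1) = s / (((k : ℝ) + 1) * (k + 1 + ν)) * b k := by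
    intro k
    have hk : (0 : ℝ) ≤ k := k.cast_nonneg
    have hG := one_le_Gamma_natCast_add hν k
    have hG1 : Real.Gamma (((k + 1 : ℕ) : ℝ) + ν + 1)
        = ((k : ℝ) + 1 + ν) * Real.Gamma ((k : ℝ) + ν + 1) := by
      rw [show ((k + 1 : ℕ) : ℝ) + ν + 1 = ((k : ℝ) + ν + 1) + 1 by push_cast; ring,
        Real.Gamma_add_one (by positivity)]
      ring
    simp only [hb]
    rw [hG1, Nat.factorial_succ, pow_succ]
    have : (0 : ℝ) < k.factorial := by positivity
    push_cast
    field_simp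
  set lam : ℝ := (2 * K + 2 + ν) / (((K : ℝ) + 1) * (K + 1 + ν)) with hlam
  have hlam0 : 0 < lam := by positivity
  have hle : ∀ k, b k - b (k + 1) ≤ lam * (((k : ℝ) - K) * b k) := by
    intro k
    have hk : (0 : ℝ) ≤ k := k.cast_nonneg
    have hK0 : (0 : ℝ) ≤ K := K.cast_nonneg
    rw [hrec]
    have key : 1 - s / (((k : ℝ) + 1) * (k + 1 + ν)) ≤ lam * ((k : ℝ) - K) := by
      have h1 : ((K : ℝ) + 1) * (K + 1 + ν) / (((k : ℝ) + 1) * (k + 1 + ν))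
          ≤ s / (((k : ℝ) + 1) * (k + 1 + ν)) := by gcongr
      have h2 : lam * ((k : ℝ) - K)
          - (1 - ((K : ℝ) + 1) * (K + 1 + ν) / (((k : ℝ) + 1) * (k + 1 + ν)))
          = ((k : ℝ) - K) ^ 2 * ((2 * K + 2 + ν) * (k + K + 2 + ν) - (K + 1) * (K + 1 + ν))
            / ((((K : ℝ) + 1) * (K + 1 + ν)) * (((k : ℝ) + 1) * (k + 1 + ν))) := by
        rw [hlam]; field_simp; ring
      have h3 : 0 ≤ ((k : ℝ) - K) ^ 2 *
          ((2 * K + 2 + ν) * (k + K + 2 + ν) - (K + 1) * (K + 1 + ν))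
            / ((((K : ℝ) + 1) * (K + 1 + ν)) * (((k : ℝ) + 1) * (k + 1 + ν))) := by
        have : 0 ≤ (2 * (K : ℝ) + 2 + ν) * (k + K + 2 + ν) - (K + 1) * (K + 1 + ν) := by
          have : ((K : ℝ) + 1) * (K + 1 + ν) ≤ (2 * K + 2 + ν) * (k + K + 2 + ν) := by
            gcongr <;> linarith
          linarith
        positivity
      linarith
    nlinarith [mul_le_mul_of_nonneg_right key (hb0 k)]
  have hshift : Summable fun k => b (k + 1) := (summable_nat_add_iff 1).2 hsum
  have hsumd : Summable fun k : ℕ => ((k : ℝ) - K) * b k := by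
    simpa only [sub_mul] using hsumk.sub (hsum.mul_left (K : ℝ))
  have htel : ∑' k, (b k - b (k + 1)) = b 0 := by
    rw [hsum.tsum_sub hshift, hsum.tsum_eq_zero_add]; ring
  have := (hsum.sub hshift).tsum_le_tsum hle (hsumd.mul_left lam)
  rw [htel, tsum_mul_left] at this
  exact nonneg_of_mul_nonneg_right ((hb0 0).trans this) hlam0

lemma pow_mul_besselSeries_le {ν s ρ : ℝ} (hν : 1 ≤ ν) (hs : 0 ≤ s) (hρ : 1 ≤ ρ) (K : ℕ)
    (hK : ((K : ℝ) + 1) * (K + 1 + ν) ≤ s) :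
    ρ ^ K * besselSeries ν s ≤ besselSeries ν (ρ * s) := by
  have hρ0 : 0 < ρ := by linarith
  have hsum := summable_besselSeries hν hs
  have hsumk := summable_natCast_mul_besselSeries hν hs
  have hsumd : Summable fun k : ℕ => ((k : ℝ) - K) *
      (s ^ k / ((k.factorial : ℝ) * Real.Gamma ((k : ℝ) + ν + 1))) := by
    simpa only [sub_mul] using hsumk.sub (hsum.mul_left (K : ℝ))
  have hterm : ∀ k : ℕ, ρ ^ K * (s ^ k / ((k.factorial : ℝ) * Real.Gamma ((k : ℝ) + ν + 1)))
      + ρ ^ K * Real.log ρ * (((k : ℝ) - K) *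
        (s ^ k / ((k.factorial : ℝ) * Real.Gamma ((k : ℝ) + ν + 1))))
      ≤ (ρ * s) ^ k / ((k.factorial : ℝ) * Real.Gamma ((k : ℝ) + ν + 1)) := by
    intro k
    have hpow : ρ ^ K * (1 + Real.log ρ * ((k : ℝ) - K)) ≤ ρ ^ k := by
      have h1 : ρ ^ k = ρ ^ K * Real.exp (Real.log ρ * ((k : ℝ) - K)) := by
        rw [← Real.rpow_def_of_pos hρ0, ← Real.rpow_natCast ρ K, ← Real.rpow_add hρ0,
          ← Real.rpow_natCast]
        congr 1; ring
      rw [h1]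
      gcongr
      linarith [Real.add_one_le_exp (Real.log ρ * ((k : ℝ) - K))]
    have := mul_le_mul_of_nonneg_right hpow (besselSeries_term_nonneg hν hs k)
    rw [mul_pow]
    calc _ = ρ ^ K * (1 + Real.log ρ * ((k : ℝ) - K)) *
          (s ^ k / ((k.factorial : ℝ) * Real.Gamma ((k : ℝ) + ν + 1))) := by ring
      _ ≤ _ := this
      _ = _ := by ring
  have hle := ((hsum.mul_left (ρ ^ K)).add (hsumd.mul_left (ρ ^ K * Real.log ρ))).tsum_le_tsum
    hterm (summable_besselSeries hν (by positivity))
  rw [(hsum.mul_left (ρ ^ K)).tsum_add (hsumd.mul_left (ρ ^ K * Real.log ρ)), tsum_mul_left,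
    tsum_mul_left] at hle
  have h0 := mul_nonneg (mul_nonneg (pow_nonneg hρ0.le K) (Real.log_nonneg hρ))
    (tsum_sub_mul_besselSeries_nonneg hν hs K hK)
  change ρ ^ K * besselSeries ν s + _ ≤ besselSeries ν (ρ * s) at hle
  linarith

lemma prod_shift_le_pow (k : ℕ) :
    (42 / 10 ^ 14 : ℝ) * (((k : ℝ) + 8) * ∏ i ∈ Finset.range 7,
      (((k : ℝ) + i + 1) * (k + i + 27 / 2))) ≤ (5 / 2) ^ (k + 8) := by
  rcases le_total k 10 with hk | hk
  · interval_cases k <;> norm_num [Finset.prod_range_succ]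
  · induction k, hk using Nat.le_induction with
    | base => norm_num [Finset.prod_range_succ]
    | succ k hk ih =>
      have hk' : (10 : ℝ) ≤ k := by exact_mod_cast hk
      have hstep : (((k + 1 : ℕ) : ℝ) + 8) * ∏ i ∈ Finset.range 7,
          ((((k + 1 : ℕ) : ℝ) + i + 1) * (((k + 1 : ℕ) : ℝ) + i + 27 / 2))
          ≤ 5 / 2 * (((k : ℝ) + 8) * ∏ i ∈ Finset.range 7,
            (((k : ℝ) + i + 1) * (k + i + 27 / 2))) := by
        simp only [Finset.prod_range_succ, Finset.prod_range_zero, Nat.cast_add, Nat.cast_one,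
          Nat.cast_zero, Nat.cast_ofNat, one_mul]
        have h : ((k : ℝ) + 9) * (k + 41 / 2) ≤ 5 / 2 * ((k + 1) * (k + 27 / 2)) := by
          nlinarith
        have hP : 0 ≤ ((k : ℝ) + 2) * (k + 3) * (k + 4) * (k + 5) * (k + 6) * (k + 7) * (k + 8)
          * ((k + 29 / 2) * (k + 31 / 2) * (k + 33 / 2) * (k + 35 / 2) * (k + 37 / 2)
            * (k + 39 / 2)) := by positivity
        have := mul_le_mul_of_nonneg_right h hP
        calc _ = _ := by ring
          _ ≤ _ := this
          _ = _ := by ring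
      rw [show k + 1 + 8 = (k + 8) + 1 by ring, pow_succ (5 / 2 : ℝ)]
      linarith

lemma Gamma_add_natCast {x : ℝ} (hx : 0 < x) (j : ℕ) :
    Real.Gamma (x + j) = (∏ i ∈ Finset.range j, (x + i)) * Real.Gamma x := by
  induction j with
  | zero => simp
  | succ j ih =>
    rw [Finset.prod_range_succ, Nat.cast_succ, ← add_assoc, Real.Gamma_add_one (by positivity), ih]
    ring

lemma factorial_add_natCast (k j : ℕ) :
    ((k + j).factorial : ℝ) = (∏ i ∈ Finset.range j, ((k : ℝ) + i + 1)) * k.factorial := by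
  induction j with
  | zero => simp
  | succ j ih =>
    rw [Finset.prod_range_succ, ← add_assoc, Nat.factorial_succ]
    push_cast
    rw [ih]
    ring

lemma pow_eight_mul_besselSeries_le {t : ℝ} (ht : 0 ≤ t) :
    42 / 10 ^ 14 * t ^ 8 * besselSeries (25 / 2) t ≤ besselSeries (23 / 2) (5 / 2 * t) := by
  have hs := summable_besselSeries (ν := 23 / 2) (t := 5 / 2 * t) (by norm_num) (by positivity)
  have hs8 := (summable_nat_add_iff 8).2 hs
  have hle : ∑' k : ℕ, (5 / 2 * t) ^ (k + 8) /
      (((k + 8).factorial : ℝ) * Real.Gamma (((k + 8 : ℕ) : ℝ) + 23 / 2 + 1))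
      ≤ besselSeries (23 / 2) (5 / 2 * t) := by
    rw [besselSeries, ← hs.sum_add_tsum_nat_add 8]
    have := Finset.sum_nonneg fun (i : ℕ) (_ : i ∈ Finset.range 8) =>
      besselSeries_term_nonneg (ν := 23 / 2) (t := 5 / 2 * t) (by norm_num) (by positivity) i
    linarith
  refine le_trans ?_ hle
  rw [besselSeries, ← tsum_mul_left]
  refine Summable.tsum_le_tsum (fun k => ?_)
    ((summable_besselSeries (by norm_num) ht).mul_left _) hs8
  have hG := one_le_Gamma_natCast_add (ν := 25 / 2) (by norm_num) k
  have hΓ : Real.Gamma (((k + 8 : ℕ) : ℝ) + 23 / 2 + 1)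
      = (∏ i ∈ Finset.range 7, ((k : ℝ) + i + 27 / 2)) * Real.Gamma ((k : ℝ) + 25 / 2 + 1) := by
    have := Gamma_add_natCast (x := (k : ℝ) + 25 / 2 + 1) (by positivity) 7
    rw [show ((k + 8 : ℕ) : ℝ) + 23 / 2 + 1 = (k : ℝ) + 25 / 2 + 1 + (7 : ℕ) by push_cast; ring,
      this]
    congr 1
    exact Finset.prod_congr rfl fun i _ => by ring
  have hf : ((k + 8).factorial : ℝ)
      = (((k : ℝ) + 8) * ∏ i ∈ Finset.range 7, ((k : ℝ) + i + 1)) * k.factorial := by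
    rw [factorial_add_natCast, Finset.prod_range_succ]
    push_cast
    ring
  have hk := prod_shift_le_pow k
  rw [Finset.prod_mul_distrib] at hk
  rw [hΓ, hf, mul_pow]
  set P := ∏ i ∈ Finset.range 7, ((k : ℝ) + i + 1) with hP
  set Q := ∏ i ∈ Finset.range 7, ((k : ℝ) + i + 27 / 2) with hQ
  have hP0 : 0 < P := Finset.prod_pos fun i _ => by positivity
  have hQ0 : 0 < Q := Finset.prod_pos fun i _ => by positivity
  set Γ' := Real.Gamma ((k : ℝ) + 25 / 2 + 1)
  have hf0 : (0 : ℝ) < k.factorial := by positivity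
  rw [show (5 / 2 : ℝ) ^ (k + 8) * t ^ (k + 8) /
      ((((k : ℝ) + 8) * P) * k.factorial * (Q * Γ'))
      = ((5 / 2 : ℝ) ^ (k + 8) / (((k : ℝ) + 8) * (P * Q))) * t ^ 8 *
        (t ^ k / (k.factorial * Γ')) by
    rw [pow_add t]; field_simp]
  refine mul_le_mul_of_nonneg_right (mul_le_mul_of_nonneg_right ?_ (by positivity))
    (by positivity)
  rwa [le_div_iff₀ (by positivity)]

lemma one_add_mul_add_sq_le_pow {x : ℝ} (hx : 0 ≤ x) (n : ℕ) :
    1 + n * x + n * (n - 1) / 2 * x ^ 2 ≤ (1 + x) ^ n := by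
  induction n with
  | zero => simp
  | succ n ih =>
    have h0 : 0 ≤ (n : ℝ) * (n - 1) := by
      rcases n.eq_zero_or_pos with rfl | hn
      · simp
      · have : (1 : ℝ) ≤ n := by exact_mod_cast hn
        exact mul_nonneg (by linarith) (by linarith)
    have h1 := mul_le_mul_of_nonneg_right ih (by linarith : 0 ≤ 1 + x)
    have h2 : 0 ≤ (n : ℝ) * (n - 1) * x ^ 3 := by positivity
    rw [pow_succ (1 + x)]
    push_cast
    nlinarith

lemma mul_besselSeries_lt_of_six_le (m : ℕ) (hm : 6 ≤ m) :
    ∀ t : ℝ, 29.6 * m ≤ t →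
      76 * ((4 / 3) ^ 24 * 5 ^ (m + 1)) * (2 * m + 3) * 4 ^ 11 / ((m : ℝ) + 4) ^ 12 *
        besselSeries (25 / 2) t < besselSeries (23 / 2) (((m : ℝ) + 4) / 4 * t) := by
  induction m, hm using Nat.le_induction with
  | base =>
    intro t ht
    norm_num at ht
    have h := pow_eight_mul_besselSeries_le (t := t) (by linarith)
    have hpos := besselSeries_pos (ν := 25 / 2) (t := t) (by norm_num) (by linarith)
    have h8 : (888 / 5 : ℝ) ^ 8 ≤ t ^ 8 := by gcongr
    have h1 : (400000 : ℝ) ≤ 42 / 10 ^ 14 * t ^ 8 := by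
      refine le_trans ?_ (mul_le_mul_of_nonneg_left h8 (by norm_num))
      norm_num
    have h2 : (76 : ℝ) * ((4 / 3) ^ 24 * 5 ^ (6 + 1)) * (2 * (6 : ℕ) + 3) * 4 ^ 11 /
        (((6 : ℕ) : ℝ) + 4) ^ 12 < 400000 := by norm_num
    have h3 : (((6 : ℕ) : ℝ) + 4) / 4 = 5 / 2 := by norm_num
    rw [h3]
    exact (mul_lt_mul_of_pos_right (h2.trans_le h1) hpos).trans_le h
  | succ m hm ih =>
    intro t ht
    have hm' : (6 : ℝ) ≤ m := by exact_mod_cast hm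
    push_cast at ht ⊢
    have ht' : 29.6 * (m : ℝ) ≤ t := by linarith
    have ht0 : 0 ≤ t := by linarith
    have hpos := besselSeries_pos (ν := 25 / 2) (t := t) (by norm_num) ht0
    have hgrow := pow_mul_besselSeries_le (ν := 23 / 2) (s := ((m : ℝ) + 4) / 4 * t)
      (ρ := ((m : ℝ) + 5) / (m + 4)) (by norm_num) (by positivity)
      (by rw [le_div_iff₀ (by positivity)]; linarith) (2 * m) (by
        push_cast
        have : ((m : ℝ) + 4) / 4 * (29.6 * m) ≤ ((m : ℝ) + 4) / 4 * t := by gcongr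
        refine le_trans ?_ this
        norm_num
        nlinarith)
    rw [show ((m : ℝ) + 5) / (m + 4) * (((m : ℝ) + 4) / 4 * t) = ((m : ℝ) + 1 + 4) / 4 * t by
      field_simp; ring] at hgrow
    refine lt_of_lt_of_le ?_ hgrow
    refine lt_of_le_of_lt ?_ (mul_lt_mul_of_pos_left (ih t ht') (by positivity))
    rw [← mul_assoc (_ ^ (2 * m))]
    refine mul_le_mul_of_nonneg_right ?_ hpos.le
    have hN : (0 : ℝ) < (m : ℝ) + 4 := by positivity
    have hρ : 5 * (2 * (m : ℝ) + 5) / (2 * m + 3) ≤ (((m : ℝ) + 5) / (m + 4)) ^ (2 * m + 12) := by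
      have hb : (5 / 2 : ℝ) ≤ (((m : ℝ) + 5) / (m + 4)) ^ (m + 6) := by
        have e : ((m : ℝ) + 5) / (m + 4) = 1 + 1 / (m + 4) := by field_simp; ring
        set x : ℝ := 1 / ((m : ℝ) + 4) with hx
        have hx0 : 0 ≤ x := by positivity
        have hxN : x * (m + 4) = 1 := by rw [hx]; field_simp
        have hb := one_add_mul_add_sq_le_pow hx0 (m + 6)
        push_cast at hb
        rw [e]
        refine le_trans ?_ hb
        nlinarith [sq_nonneg x]
      calc 5 * (2 * (m : ℝ) + 5) / (2 * m + 3) ≤ (5 / 2) ^ 2 := by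
            rw [div_le_iff₀ (by positivity)]; linarith
        _ ≤ ((((m : ℝ) + 5) / (m + 4)) ^ (m + 6)) ^ 2 := by gcongr
        _ = _ := by rw [← pow_mul]; congr 1; ring
    rw [div_le_iff₀ (by positivity)] at hρ
    have e1 : (((m : ℝ) + 5) / (m + 4)) ^ (2 * m + 12)
      = (((m : ℝ) + 5) / (m + 4)) ^ (2 * m) * ((m + 5) ^ 12 / (m + 4) ^ 12) := by
      rw [pow_add, div_pow _ _ 12]
    rw [e1] at hρ
    rw [show (m : ℝ) + 1 + 4 = m + 5 by ring, div_le_iff₀ (by positivity), pow_succ (5 : ℝ) (m + 1)]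
    set R := (((m : ℝ) + 5) / (m + 4)) ^ (2 * m)
    clear_value R
    calc _ = 76 * ((4 / 3) ^ 24 * 5 ^ (m + 1)) * 4 ^ 11 * (5 * (2 * (m : ℝ) + 5)) := by ring
      _ ≤ 76 * ((4 / 3) ^ 24 * 5 ^ (m + 1)) * 4 ^ 11 *
          (R * ((m + 5) ^ 12 / (m + 4) ^ 12) * (2 * m + 3)) := by gcongr
      _ = _ := by ring

lemma card_partition_le (n : ℕ) : Fintype.card (Nat.Partition n) ≤ 2 ^ (n - 1) := by
  rw [← composition_card]
  exact Fintype.card_le_of_surjective _ Nat.Partition.ofComposition_surj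

lemma sum_card_partition_div_le (N : ℕ) :
    ∑ k ∈ Finset.range (N + 1), (Fintype.card (Nat.Partition k) : ℝ) / 5 ^ k ≤ 4 / 3 := by
  have h : ∑ k ∈ Finset.range (N + 1), (Fintype.card (Nat.Partition k) : ℝ) / 5 ^ k
      ≤ 4 / 3 - 1 / 3 * (2 / 5) ^ N := by
    induction N with
    | zero => simp; norm_num
    | succ N ih =>
      rw [Finset.sum_range_succ]
      have : (Fintype.card (Nat.Partition (N + 1)) : ℝ) ≤ 2 ^ N := by
        exact_mod_cast card_partition_le (N + 1)
      have h2 : (Fintype.card (Nat.Partition (N + 1)) : ℝ) / 5 ^ (N + 1)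
          ≤ 1 / 5 * (2 / 5) ^ N := by
        rw [div_pow, pow_succ, div_le_iff₀ (by positivity)]
        calc _ ≤ _ := this
          _ = _ := by field_simp
      rw [pow_succ (2 / 5 : ℝ)]
      linarith
  have : (0 : ℝ) ≤ 1 / 3 * (2 / 5) ^ N := by positivity
  linarith

lemma dcoef_natCast_nonneg (m : ℕ) : (0 : ℝ) ≤ dcoef m := by
  have : 0 ≤ dcoef m := by
    rw [dcoef]
    split_ifs
    · exact Finset.sum_nonneg fun v _ => Finset.prod_nonneg fun i _ => by positivity
    · exact le_rfl
  exact_mod_cast this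

lemma dcoef_natCast_le (m : ℕ) : (dcoef m : ℝ) ≤ (4 / 3) ^ 24 * 5 ^ (m + 1) := by
  have hN : ((m : ℤ) + 1).toNat = m + 1 := by omega
  rw [dcoef, if_pos (by positivity), hN]
  push_cast
  rw [← div_le_iff₀ (by positivity), Finset.sum_div]
  calc ∑ v ∈ Finset.Nat.antidiagonalTuple 24 (m + 1),
        (∏ i, (Fintype.card (Nat.Partition (v i)) : ℝ)) / 5 ^ (m + 1)
      = ∑ v ∈ Finset.Nat.antidiagonalTuple 24 (m + 1),
        ∏ i, ((Fintype.card (Nat.Partition (v i)) : ℝ) / 5 ^ (v i)) := by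
        refine Finset.sum_congr rfl fun v hv => ?_
        rw [Finset.prod_div_distrib, Finset.prod_pow_eq_pow_sum,
          Finset.Nat.mem_antidiagonalTuple.1 hv]
    _ ≤ ∑ v ∈ Fintype.piFinset fun _ : Fin 24 => Finset.range (m + 1 + 1),
        ∏ i, ((Fintype.card (Nat.Partition (v i)) : ℝ) / 5 ^ (v i)) := by
        refine Finset.sum_le_sum_of_subset_of_nonneg (fun v hv => ?_)
          fun v _ _ => Finset.prod_nonneg fun i _ => by positivity
        rw [Fintype.mem_piFinset]
        intro i
        rw [Finset.mem_range, Nat.lt_succ_iff, ← Finset.Nat.mem_antidiagonalTuple.1 hv]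
        exact Finset.single_le_sum (f := v) (fun _ _ => Nat.zero_le _) (Finset.mem_univ i)
    _ = ∏ _i : Fin 24, ∑ k ∈ Finset.range (m + 1 + 1),
        (Fintype.card (Nat.Partition k) : ℝ) / 5 ^ k := by
        rw [Finset.prod_univ_sum]
    _ ≤ ∏ _i : Fin 24, (4 / 3 : ℝ) :=
        Finset.prod_le_prod (fun _ _ => Finset.sum_nonneg fun _ _ => by positivity)
          fun _ _ => sum_card_partition_div_le _
    _ = (4 / 3) ^ 24 := by rw [Finset.prod_const, Finset.card_univ, Fintype.card_fin]

lemma norm_psiMult_le (m γ : ℕ) (hm : 0 < m) (hγ : 0 < γ) (δ ℓt ℓ : ℤ) :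
    ‖psiMult m γ δ ℓt ℓ‖ ≤ (2 * m * γ : ℝ) ^ (-(1 / 2 : ℝ)) * γ := by
  rw [psiMult, norm_mul]
  have hmγ : ((2 * m * γ : ℕ) : ℂ) ≠ 0 := by
    have : 2 * m * γ ≠ 0 := by positivity
    exact_mod_cast this
  gcongr
  · rw [Complex.norm_cpow_of_ne_zero (mul_ne_zero hmγ Complex.I_ne_zero)]
    simp
  · refine (norm_sum_le _ _).trans ?_
    refine (Finset.sum_le_card_nsmul _ _ 1 fun T _ => ?_).trans (by simp)
    generalize ((δ : ZMod γ)⁻¹).val = a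
    rw [show 2 * (Real.pi : ℂ) * Complex.I *
        (((a : ℂ) * ((ℓt : ℂ) - 2 * m * T) ^ 2) / (4 * m * γ)
          - ((ℓ : ℂ) * ((ℓt : ℂ) - 2 * m * T)) / (2 * m * γ)
          + ((δ : ℂ) * (ℓ : ℂ) ^ 2) / (4 * m * γ))
        = ((2 * Real.pi * (((a : ℝ) * ((ℓt : ℝ) - 2 * m * T) ^ 2) / (4 * m * γ)
          - ((ℓ : ℝ) * ((ℓt : ℝ) - 2 * m * T)) / (2 * m * γ)
          + ((δ : ℝ) * (ℓ : ℝ) ^ 2) / (4 * m * γ)) : ℝ) : ℂ) * Complex.I by push_cast; ring,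
      Complex.norm_exp_ofReal_mul_I]

lemma norm_Kl_le (m γ : ℕ) (hm : 0 < m) (hγ : 0 < γ) (A B : ℚ) (ℓ ℓt : ℤ) :
    ‖Kl m A B γ ℓ ℓt‖ ≤ γ * ((2 * m * γ : ℝ) ^ (-(1 / 2 : ℝ)) * γ) := by
  rw [Kl]
  refine (norm_sum_le _ _).trans ?_
  refine (Finset.sum_le_card_nsmul _ _ ((2 * m * γ : ℝ) ^ (-(1 / 2 : ℝ)) * γ)
    fun j _ => ?_).trans ?_
  · rw [norm_mul]
    generalize (((-(j : ℤ) : ZMod γ)⁻¹).val) = a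
    rw [show 2 * (Real.pi : ℂ) * Complex.I *
        ((a : ℂ) * (B : ℂ) / γ + ((-(j : ℤ) : ℤ) : ℂ) * (A : ℂ) / γ)
        = ((2 * Real.pi * ((a : ℝ) * (B : ℝ) / γ + ((-(j : ℤ) : ℤ) : ℝ) * (A : ℝ) / γ) : ℝ) : ℂ)
          * Complex.I by push_cast; ring, Complex.norm_exp_ofReal_mul_I, one_mul]
    exact norm_psiMult_le m γ hm hγ _ _ _
  · rw [nsmul_eq_mul]
    gcongr
    exact (Finset.card_filter_le _ _).trans (by simp)

lemma sinh_le_mul_cosh {u : ℝ} (hu : 0 ≤ u) : Real.sinh u ≤ u * Real.cosh u := by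
  have hd : ∀ x : ℝ, HasDerivAt (fun x => x * Real.cosh x - Real.sinh x) (x * Real.sinh x) x := by
    intro x
    exact (((hasDerivAt_id' x).mul (Real.hasDerivAt_cosh x)).sub
      (Real.hasDerivAt_sinh x)).congr_deriv (by ring)
  have hmono : MonotoneOn (fun x => x * Real.cosh x - Real.sinh x) (Set.Ici 0) := by
    refine monotoneOn_of_deriv_nonneg (convex_Ici 0)
      (fun x _ => (hd x).continuousAt.continuousWithinAt)
      (fun x _ => (hd x).differentiableAt.differentiableWithinAt) fun x hx => ?_
    rw [interior_Ici, Set.mem_Ioi] at hx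
    rw [(hd x).deriv]
    exact mul_nonneg hx.le (Real.sinh_nonneg_iff.2 hx.le)
  have := hmono (Set.mem_Ici.2 le_rfl) (Set.mem_Ici.2 hu) hu
  simp at this
  linarith

lemma abs_inv_sinh_sq_sub_inv_sq_le (u : ℝ) : |1 / Real.sinh u ^ 2 - 1 / u ^ 2| ≤ 1 := by
  wlog hu : 0 ≤ u generalizing u
  · simpa using this (-u) (by linarith)
  rcases hu.eq_or_lt with rfl | hu
  · simp
  have h1 := Real.self_le_sinh_iff.2 hu.le
  have h2 := sinh_le_mul_cosh hu.le
  have hs : 0 < Real.sinh u := hu.trans_le h1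
  have h3 : Real.sinh u ^ 2 ≤ u ^ 2 * (1 + Real.sinh u ^ 2) := by
    have := Real.cosh_sq u
    calc Real.sinh u ^ 2 ≤ (u * Real.cosh u) ^ 2 := by gcongr
      _ = _ := by rw [mul_pow, this]; ring
  have h4 : 1 / u ^ 2 ≤ 1 + 1 / Real.sinh u ^ 2 := by
    rw [div_le_iff₀ (by positivity)]
    field_simp
    linarith
  have h5 : 1 / Real.sinh u ^ 2 ≤ 1 / u ^ 2 := by gcongr
  rw [abs_le]
  constructor <;> linarith

lemma inv_sin_sq_le {θ : ℝ} (h0 : θ ≠ 0) (h1 : |θ| ≤ Real.pi / 2) :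
    1 / Real.sin θ ^ 2 ≤ 1 + 1 / θ ^ 2 := by
  wlog hθ : 0 < θ generalizing θ
  · simpa using this (θ := -θ) (by simpa) (by simpa) (by
      have := lt_of_le_of_ne (not_lt.1 hθ) h0
      linarith)
  rw [abs_of_pos hθ] at h1
  have hs : 0 < Real.sin θ := Real.sin_pos_of_pos_of_lt_pi hθ (by linarith [Real.pi_pos])
  have hc : 0 ≤ Real.cos θ := Real.cos_nonneg_of_neg_pi_div_two_le_of_le (by linarith) h1
  have h2 : θ * Real.cos θ ≤ Real.sin θ := by
    rcases h1.eq_or_lt with rfl | h1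
    · simp
    · have := Real.lt_tan hθ h1
      have hc' : 0 < Real.cos θ := Real.cos_pos_of_mem_Ioo ⟨by linarith, h1⟩
      rw [Real.tan_eq_sin_div_cos, lt_div_iff₀ hc'] at this
      exact this.le
  have h3 : θ ^ 2 * (1 - Real.sin θ ^ 2) ≤ Real.sin θ ^ 2 := by
    calc _ = (θ * Real.cos θ) ^ 2 := by rw [mul_pow, Real.cos_sq']
      _ ≤ _ := by gcongr
  rw [div_le_iff₀ (by positivity)]
  field_simp
  linarith

lemma abs_sin_le_norm_sinh_sub_mul_I (a b : ℝ) :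
    |Real.sin b| ≤ ‖Complex.sinh ((a : ℂ) - b * Complex.I)‖ := by
  refine le_trans ?_ (Complex.abs_im_le_norm _)
  rw [Complex.sinh_sub, Complex.sinh_mul_I, Complex.cosh_mul_I, ← Complex.ofReal_sinh,
    ← Complex.ofReal_cosh, ← Complex.ofReal_sin, ← Complex.ofReal_cos]
  simp only [Complex.sub_im, Complex.mul_im, Complex.ofReal_re, Complex.ofReal_im, Complex.I_re,
    Complex.I_im, Complex.mul_re]
  norm_num [abs_mul]
  exact le_mul_of_one_le_left (abs_nonneg _) ((Real.one_le_cosh a).trans (le_abs_self _))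

lemma norm_fFun_le (m γ : ℕ) (hm : 0 < m) (hγ : 0 < γ) (g : ℤ)
    (hg : g ∈ Finset.Ioc (-(m : ℤ) * γ) ((m : ℤ) * γ)) (x : ℝ) :
    ‖fFun m γ g x‖ ≤ Real.pi ^ 2 + 4 * (m : ℝ) ^ 2 * γ ^ 2 * (1 / (g : ℝ) ^ 2) := by
  have hγ' : (0 : ℝ) < γ := by exact_mod_cast hγ
  have hm' : (0 : ℝ) < m := by exact_mod_cast hm
  have hpi := Real.pi_pos
  rw [Finset.mem_Ioc] at hg
  rw [fFun]
  split_ifs with h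
  · rw [Complex.norm_real, Real.norm_eq_abs]
    rw [show Real.pi ^ 2 / Real.sinh (Real.pi * x / γ) ^ 2 - (γ : ℝ) ^ 2 / x ^ 2
      = Real.pi ^ 2 * (1 / Real.sinh (Real.pi * x / γ) ^ 2 - 1 / (Real.pi * x / γ) ^ 2) by
        rw [mul_sub, mul_one_div, div_pow, mul_pow]; field_simp, abs_mul, abs_of_pos (by positivity)]
    have := abs_inv_sinh_sq_sub_inv_sq_le (Real.pi * x / γ)
    have h2 : 0 ≤ 4 * (m : ℝ) ^ 2 * γ ^ 2 * (1 / (g : ℝ) ^ 2) := by positivity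
    nlinarith [sq_nonneg Real.pi]
  · have hg0 : g ≠ 0 := by rintro rfl; simp at h
    have hg0' : (g : ℝ) ≠ 0 := by exact_mod_cast hg0
    set θ : ℝ := Real.pi * g / (2 * m * γ) with hθ
    have hθ0 : θ ≠ 0 := by positivity
    have hgabs : |(g : ℝ)| ≤ m * γ := by
      rw [abs_le]
      constructor
      · have := hg.1.le
        rw [neg_mul] at this
        exact_mod_cast this
      · exact_mod_cast hg.2
    have hθ1 : |θ| ≤ Real.pi / 2 := by
      rw [hθ, abs_div, abs_mul, abs_of_pos hpi, abs_of_pos (show (0 : ℝ) < 2 * m * γ by positivity),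
        div_le_iff₀ (by positivity)]
      nlinarith
    have hsin : 0 < |Real.sin θ| := by
      rw [abs_pos]
      rcases lt_or_gt_of_ne hθ0 with h | h
      · exact (Real.sin_neg_of_neg_of_neg_pi_lt h (by linarith [(abs_le.1 hθ1).1])).ne
      · exact (Real.sin_pos_of_pos_of_lt_pi h (by linarith [(abs_le.1 hθ1).2])).ne'
    have hn := abs_sin_le_norm_sinh_sub_mul_I (Real.pi * x / γ) θ
    rw [show (Real.pi : ℂ) * x / γ - (Real.pi : ℂ) * Complex.I * g / (2 * m * γ)
      = ((Real.pi * x / γ : ℝ) : ℂ) - (θ : ℂ) * Complex.I by rw [hθ]; push_cast; ring, norm_div,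
      norm_pow, norm_pow, Complex.norm_real, Real.norm_eq_abs, abs_of_pos hpi]
    calc Real.pi ^ 2 / ‖Complex.sinh (((Real.pi * x / γ : ℝ) : ℂ) - (θ : ℂ) * Complex.I)‖ ^ 2
        ≤ Real.pi ^ 2 / |Real.sin θ| ^ 2 := by gcongr
      _ = Real.pi ^ 2 * (1 / Real.sin θ ^ 2) := by rw [sq_abs]; ring
      _ ≤ Real.pi ^ 2 * (1 + 1 / θ ^ 2) := by
        gcongr
        exact inv_sin_sq_le hθ0 hθ1
      _ = _ := by rw [hθ]; field_simp; ring

lemma norm_innerInt_le (m γ : ℕ) (hm : 0 < m) (hγ : 0 < γ) (g Δ : ℤ) (hΔ : 0 ≤ Δ)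
    (hg : g ∈ Finset.Ioc (-(m : ℤ) * γ) ((m : ℤ) * γ)) :
    ‖innerInt m γ g Δ‖ ≤
      (Real.pi ^ 2 + 4 * (m : ℝ) ^ 2 * γ ^ 2 * (1 / (g : ℝ) ^ 2)) *
        ((1 / (γ : ℝ)) ^ (25 / 2 : ℝ) *
          besselI (25 / 2) (2 * Real.pi * Real.sqrt ((Δ : ℝ) / m))) *
        Real.sqrt (Real.pi / (25 / 2 * m)) := by
  have hγ' : (1 : ℝ) ≤ γ := by exact_mod_cast hγ
  have hm' : (0 : ℝ) < m := by exact_mod_cast hm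
  have hΔ' : (0 : ℝ) ≤ Δ := by exact_mod_cast hΔ
  set B : ℝ := Real.pi ^ 2 + 4 * (m : ℝ) ^ 2 * γ ^ 2 * (1 / (g : ℝ) ^ 2) with hB
  set z : ℝ := 2 * Real.pi * Real.sqrt ((Δ : ℝ) / m) with hz
  have hz0 : 0 ≤ z := by positivity
  have hI0 : 0 ≤ besselI (25 / 2) z := besselI_nonneg (by norm_num) hz0
  set C : ℝ := (1 / (γ : ℝ)) ^ (25 / 2 : ℝ) * besselI (25 / 2) z with hC
  have hC0 : 0 ≤ C := by positivity
  have hB0 : 0 ≤ B := by positivity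
  have hint : MeasureTheory.Integrable
      (fun x : ℝ => B * C * Real.exp (-(25 / 2 * m) * x ^ 2)) :=
    (integrable_exp_neg_mul_sq (by positivity)).const_mul _
  have hle : -(1 : ℝ) / Real.sqrt m ≤ 1 / Real.sqrt m := by
    gcongr; norm_num
  rw [innerInt]
  refine (intervalIntegral.norm_integral_le_of_norm_le
    (g := fun x : ℝ => B * C * Real.exp (-(25 / 2 * m) * x ^ 2)) hle
    (MeasureTheory.ae_of_all _ fun x hx => ?_) hint.intervalIntegrable).trans ?_
  · have hx1 : (m : ℝ) * x ^ 2 ≤ 1 := by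
      have : |x| ≤ 1 / Real.sqrt m := abs_le.2 ⟨by rw [← neg_div]; exact hx.1.le, hx.2⟩
      have h2 : x ^ 2 ≤ (1 / Real.sqrt m) ^ 2 := by rw [← sq_abs]; gcongr
      rw [div_pow, Real.sq_sqrt hm'.le, one_pow, le_div_iff₀ hm'] at h2
      linarith
    set w : ℝ := 1 - m * x ^ 2 with hw
    have hw0 : 0 ≤ w := by linarith
    have hw1 : w ≤ 1 := by rw [hw]; nlinarith [sq_nonneg x]
    have harg : 2 * Real.pi * Real.sqrt ((Δ : ℝ) * w) / (γ * Real.sqrt m)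
        = z * (Real.sqrt w * (1 / γ)) := by
      rw [hz, Real.sqrt_mul hΔ', Real.sqrt_div hΔ']
      ring
    have hI : besselI (25 / 2) (z * (Real.sqrt w * (1 / γ))) ≤ w ^ (25 / 4 : ℝ) * C := by
      refine (besselI_mul_le (by norm_num) hz0 (by positivity) ?_).trans (le_of_eq ?_)
      · exact mul_le_one₀ (Real.sqrt_le_one.2 hw1) (by positivity)
          ((div_le_one (by linarith)).2 hγ')
      · rw [Real.mul_rpow (by positivity) (by positivity), hC, mul_assoc, Real.sqrt_eq_rpow,
          ← Real.rpow_mul hw0]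
        norm_num
    have hI0' : 0 ≤ besselI (25 / 2) (z * (Real.sqrt w * (1 / γ))) :=
      besselI_nonneg (by norm_num) (by positivity)
    have hexp : w ^ (25 / 4 : ℝ) * w ^ (25 / 4 : ℝ) ≤ Real.exp (-(25 / 2 * m) * x ^ 2) := by
      rw [← Real.rpow_add_of_nonneg hw0 (by norm_num) (by norm_num)]
      have : w ≤ Real.exp (-(m * x ^ 2)) := by
        rw [hw]; linarith [Real.add_one_le_exp (-((m : ℝ) * x ^ 2))]
      calc w ^ (25 / 4 + 25 / 4 : ℝ) ≤ Real.exp (-(m * x ^ 2)) ^ (25 / 4 + 25 / 4 : ℝ) := by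
            gcongr
        _ = _ := by rw [← Real.exp_mul]; congr 1; ring
    rw [harg, norm_mul, norm_mul, Complex.norm_real, Complex.norm_real,
      Real.norm_of_nonneg (by positivity), Real.norm_of_nonneg hI0']
    calc ‖fFun m γ g x‖ * w ^ (25 / 4 : ℝ) * besselI (25 / 2) (z * (Real.sqrt w * (1 / γ)))
        ≤ B * w ^ (25 / 4 : ℝ) * (w ^ (25 / 4 : ℝ) * C) := by
          gcongr
          exact norm_fFun_le m γ hm hγ g hg x
      _ = B * C * (w ^ (25 / 4 : ℝ) * w ^ (25 / 4 : ℝ)) := by ring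
      _ ≤ _ := by gcongr
  · rw [intervalIntegral.integral_of_le hle]
    refine (MeasureTheory.setIntegral_le_integral hint
      (MeasureTheory.ae_of_all _ fun x => by positivity)).trans (le_of_eq ?_)
    rw [MeasureTheory.integral_const_mul, integral_gaussian]

lemma sum_Ioc_one_div_sq_le (M : ℤ) :
    ∑ g ∈ Finset.Ioc (-M) M, 1 / (g : ℝ) ^ 2 ≤ Real.pi ^ 2 / 3 := by
  have h : HasSum (fun g : ℤ => 1 / (g : ℝ) ^ 2)
      (Real.pi ^ 2 / 6 + Real.pi ^ 2 / 6 - 1 / ((0 : ℤ) : ℝ) ^ 2) :=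
    HasSum.of_nat_of_neg (by simpa using hasSum_zeta_two) (by simpa using hasSum_zeta_two)
  refine (sum_le_hasSum _ (fun g _ => by positivity) h).trans (le_of_eq ?_)
  norm_num
  ring

lemma sum_norm_fFun_bound_le (m γ : ℕ) (hγ : 0 < γ) :
    ∑ g ∈ Finset.Ioc (-(m : ℤ) * γ) ((m : ℤ) * γ),
      (Real.pi ^ 2 + 4 * (m : ℝ) ^ 2 * γ ^ 2 * (1 / (g : ℝ) ^ 2)) ≤
      (γ : ℝ) ^ 2 * (2 * Real.pi ^ 2 / 3 * m * (2 * m + 3)) := by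
  have hγ' : (1 : ℝ) ≤ γ := by exact_mod_cast hγ
  rw [Finset.sum_add_distrib, Finset.sum_const, ← Finset.mul_sum, neg_mul, Int.card_Ioc,
    nsmul_eq_mul]
  have hc : (((((m : ℤ) * γ - -((m : ℤ) * γ))).toNat : ℕ) : ℝ) = 2 * m * γ := by
    have : ((m : ℤ) * γ - -((m : ℤ) * γ)).toNat = 2 * m * γ := by
      rw [show (m : ℤ) * γ - -((m : ℤ) * γ) = ((2 * m * γ : ℕ) : ℤ) by push_cast; ring,
        Int.toNat_natCast]
    rw [this]; push_cast; ring
  rw [hc]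
  have h1 := mul_le_mul_of_nonneg_left (sum_Ioc_one_div_sq_le ((m : ℤ) * γ))
    (show 0 ≤ 4 * (m : ℝ) ^ 2 * γ ^ 2 by positivity)
  have h2 : 2 * (m : ℝ) * γ * Real.pi ^ 2 ≤ 2 * (m : ℝ) * γ ^ 2 * Real.pi ^ 2 := by
    gcongr; nlinarith
  nlinarith

lemma sum_sum_filter_emod_le (m : ℕ) (s : Finset ℤ) (F : ℤ → ℝ)
    (hF : ∀ g ∈ s, 0 ≤ F g) :
    ∑ ℓt ∈ Finset.Icc (-(m : ℤ) + 1) (m : ℤ),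
      ∑ g ∈ s.filter (fun g => g % (2 * (m : ℤ)) = ℓt % (2 * (m : ℤ))), F g ≤ ∑ g ∈ s, F g := by
  simp_rw [Finset.sum_filter]
  rw [Finset.sum_comm]
  refine Finset.sum_le_sum fun g hg => ?_
  rw [← Finset.sum_filter, Finset.sum_const, nsmul_eq_mul]
  refine mul_le_of_le_one_left (hF g hg) ?_
  norm_cast
  refine Finset.card_le_one.2 fun a ha b hb => ?_
  simp only [Finset.mem_filter, Finset.mem_Icc] at ha hb
  have hab : a % (2 * (m : ℤ)) = b % (2 * (m : ℤ)) := ha.2.symm.trans hb.2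
  have hdvd : 2 * (m : ℤ) ∣ a - b := Int.ModEq.dvd hab.symm
  have := Int.eq_zero_of_abs_lt_dvd hdvd (by rw [abs_lt]; omega)
  omega

lemma norm_tripleTerm_le (m γ : ℕ) (hm : 0 < m) (hγ : 0 < γ) (ℓ Δ : ℤ) (hΔ : 0 ≤ Δ) :
    ‖tripleTerm m ℓ Δ γ‖ ≤
      (2 * (m : ℝ)) ^ (-(1 / 2 : ℝ)) * besselI (25 / 2) (2 * Real.pi * Real.sqrt ((Δ : ℝ) / m)) *
        Real.sqrt (Real.pi / (25 / 2 * m)) * (2 * Real.pi ^ 2 / 3 * m * (2 * m + 3)) *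
        (1 / (γ : ℝ) ^ 4) := by
  have hγ' : (1 : ℝ) ≤ γ := by exact_mod_cast hγ
  have hγ0 : (0 : ℝ) < γ := by linarith
  have hm' : (0 : ℝ) < m := by exact_mod_cast hm
  set J := besselI (25 / 2) (2 * Real.pi * Real.sqrt ((Δ : ℝ) / m)) with hJ
  have hJ0 : 0 ≤ J := besselI_nonneg (by norm_num) (by positivity)
  set S := Real.sqrt (Real.pi / (25 / 2 * m)) with hS
  set q : ℝ := (1 / (γ : ℝ)) ^ (25 / 2 : ℝ) with hq
  set r : ℝ := (2 * m * γ : ℝ) ^ (-(1 / 2 : ℝ)) with hr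
  set B : ℤ → ℝ := fun g => Real.pi ^ 2 + 4 * (m : ℝ) ^ 2 * γ ^ 2 * (1 / (g : ℝ) ^ 2) with hB
  have hB0 : ∀ g, 0 ≤ B g := fun g => by positivity
  have hterm : ‖tripleTerm m ℓ Δ γ‖ ≤
      ∑ ℓt ∈ Finset.Icc (-(m : ℤ) + 1) (m : ℤ),
        ∑ g ∈ (Finset.Ioc (-(m : ℤ) * γ) ((m : ℤ) * γ)).filter
          (fun g => g % (2 * (m : ℤ)) = ℓt % (2 * (m : ℤ))), r * (B g * (q * J) * S) := by
    rw [tripleTerm]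
    refine (norm_sum_le _ _).trans (Finset.sum_le_sum fun ℓt _ => ?_)
    refine (norm_sum_le _ _).trans (Finset.sum_le_sum fun g hg => ?_)
    rw [norm_mul, norm_mul, norm_inv, norm_pow, Complex.norm_natCast]
    calc _ ≤ γ * (r * γ) * ((γ : ℝ) ^ 2)⁻¹ * (B g * (q * J) * S) := by
          gcongr
          · exact norm_Kl_le m γ hm hγ _ _ _ _
          · exact norm_innerInt_le m γ hm hγ g Δ hΔ (Finset.mem_filter.1 hg).1
      _ = _ := by field_simp
  refine hterm.trans ((sum_sum_filter_emod_le m _ _ fun g _ => by positivity).trans ?_)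
  have hfac : ∑ g ∈ Finset.Ioc (-(m : ℤ) * γ) ((m : ℤ) * γ), r * (B g * (q * J) * S)
      = r * q * J * S * ∑ g ∈ Finset.Ioc (-(m : ℤ) * γ) ((m : ℤ) * γ), B g := by
    rw [Finset.mul_sum]
    exact Finset.sum_congr rfl fun g _ => by ring
  rw [hfac]
  have hrq : r * q = (2 * (m : ℝ)) ^ (-(1 / 2 : ℝ)) * (1 / (γ : ℝ) ^ 13) := by
    rw [hr, hq, Real.mul_rpow (by positivity) hγ0.le, one_div (γ : ℝ), Real.inv_rpow hγ0.le,
      ← Real.rpow_neg hγ0.le, mul_assoc, ← Real.rpow_add hγ0,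
      show (-(1 / 2) + -(25 / 2) : ℝ) = -((13 : ℕ) : ℝ) by norm_num, Real.rpow_neg hγ0.le,
      Real.rpow_natCast, one_div ((γ : ℝ) ^ 13)]
  have hpow : 1 / (γ : ℝ) ^ 13 * (γ : ℝ) ^ 2 ≤ 1 / (γ : ℝ) ^ 4 := by
    rw [show 1 / (γ : ℝ) ^ 13 * (γ : ℝ) ^ 2 = 1 / (γ : ℝ) ^ 11 by field_simp]
    exact one_div_le_one_div_of_le (by positivity) (pow_le_pow_right₀ hγ' (by norm_num))
  calc _ ≤ r * q * J * S * ((γ : ℝ) ^ 2 * (2 * Real.pi ^ 2 / 3 * m * (2 * m + 3))) := by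
        gcongr
        exact sum_norm_fFun_bound_le m γ hγ
    _ = (2 * (m : ℝ)) ^ (-(1 / 2 : ℝ)) * J * S * (2 * Real.pi ^ 2 / 3 * m * (2 * m + 3)) *
        (1 / (γ : ℝ) ^ 13 * (γ : ℝ) ^ 2) := by rw [hrq]; ring
    _ ≤ _ := by gcongr

lemma rpow_mul_besselI {ν s z c : ℝ} (hν : 0 ≤ ν) (hs : 0 ≤ s) (hz : 0 ≤ z) (hc : 0 ≤ c)
    (h : s * (z / 2) ^ 2 = c ^ 2) :
    s ^ (ν / 2) * besselI ν z = c ^ ν * besselSeries ν (z ^ 2 / 4) := by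
  have key : ∀ y : ℝ, 0 ≤ y → y ^ ν = (y ^ 2) ^ (ν / 2) := fun y hy => by
    rw [← Real.rpow_natCast, ← Real.rpow_mul hy]
    congr 1
    push_cast
    ring
  rw [besselI_eq_rpow_mul_besselSeries hν hz, ← mul_assoc, key _ (by positivity),
    ← Real.mul_rpow hs (by positivity), h, ← key c hc]

lemma sqrt_mul_add_four_le {x : ℝ} (hx : 0 ≤ x) :
    √x * (x + 4) ≤ 2 * (x + 2) * √((x + 4) / 4) := by
  refine le_of_sq_le_sq ?_ (by positivity)
  rw [mul_pow, mul_pow, Real.sq_sqrt hx, Real.sq_sqrt (by positivity)]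
  nlinarith

lemma pi_constant_lt : √(2 * π / 25) * (2 * π / 3) * (π ^ 4 / 90) < 114 / 100 := by
  have h1 := Real.pi_lt_d4
  have h0 := Real.pi_pos
  have h2 : √(2 * π / 25) ≤ 0.5014 := by
    rw [Real.sqrt_le_iff]
    constructor <;> linarith
  calc √(2 * π / 25) * (2 * π / 3) * (π ^ 4 / 90)
      ≤ 0.5014 * (2 * 3.1416 / 3) * (3.1416 ^ 4 / 90) := by gcongr
    _ < _ := by norm_num

lemma main_bound_lt_Cpos (m : ℕ) (hm : 6 ≤ m) (Δ : ℤ) (hΔ : 3 * (m : ℤ) ^ 2 ≤ Δ) :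
    (2 * π)⁻¹ * (dcoef m : ℝ) * ((4 * (m : ℝ)) / (Δ : ℝ)) ^ ((25 : ℝ) / 4) *
      ((2 * (m : ℝ)) ^ (-(1 / 2 : ℝ)) * besselI (25 / 2) (2 * π * √((Δ : ℝ) / m)) *
        √(π / (25 / 2 * m)) * (2 * π ^ 2 / 3 * m * (2 * m + 3))) * (π ^ 4 / 90) <
      (15 / 1000) * Cpos m Δ := by
  have hm0 : (0 : ℝ) < m := by positivity
  have hΔ' : 3 * (m : ℝ) ^ 2 ≤ (Δ : ℝ) := by exact_mod_cast hΔ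
  have hΔ0 : (0 : ℝ) < Δ := lt_of_lt_of_le (by positivity) hΔ'
  have hπ := Real.pi_pos
  have h25 := rpow_mul_besselI (ν := 25 / 2) (s := 4 * (m : ℝ) / Δ) (z := 2 * π * √((Δ : ℝ) / m))
    (c := 2 * π) (by norm_num) (by positivity) (by positivity) (by positivity) (by
      rw [div_pow, mul_pow, Real.sq_sqrt (by positivity)]
      field_simp
      ring)
  have h23 := rpow_mul_besselI (ν := 23 / 2) (s := (4 * (m : ℝ) + (m : ℝ) ^ 2) / Δ)
    (z := π * √((Δ : ℝ) * (4 * (m : ℝ) + (m : ℝ) ^ 2)) / m)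
    (c := 2 * π * (((m : ℝ) + 4) / 4)) (by norm_num) (by positivity) (by positivity)
    (by positivity) (by
      rw [div_pow, div_pow, mul_pow, Real.sq_sqrt (by positivity)]
      field_simp
      ring)
  set t : ℝ := π ^ 2 * Δ / m with ht
  rw [show (2 * π * √((Δ : ℝ) / m)) ^ 2 / 4 = t by
      rw [mul_pow, Real.sq_sqrt (by positivity)]; ring,
    show (25 / 2 / 2 : ℝ) = 25 / 4 by norm_num,
    show (25 / 2 : ℝ) = 23 / 2 + 1 by norm_num, Real.rpow_add_one (by positivity),
    show (23 / 2 + 1 : ℝ) = 25 / 2 by norm_num] at h25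
  rw [show (π * √((Δ : ℝ) * (4 * (m : ℝ) + (m : ℝ) ^ 2)) / m) ^ 2 / 4 = ((m : ℝ) + 4) / 4 * t by
      rw [div_pow, mul_pow, Real.sq_sqrt (by positivity), ht]
      field_simp
      ring,
    show (23 / 2 / 2 : ℝ) = 23 / 4 by norm_num,
    Real.mul_rpow (by positivity) (by positivity),
    show (((m : ℝ) + 4) / 4) ^ (23 / 2 : ℝ) = (((m : ℝ) + 4) / 4) ^ 11 * √(((m : ℝ) + 4) / 4) by
      rw [Real.sqrt_eq_rpow, ← Real.rpow_natCast, ← Real.rpow_add (by positivity)]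
      norm_num] at h23
  have ht' : 29.6 * m ≤ t := by
    have h1 := Real.pi_gt_d4
    rw [ht, le_div_iff₀ hm0]
    nlinarith [show (9.869 : ℝ) ≤ π ^ 2 by nlinarith, sq_nonneg (m : ℝ)]
  have hG := mul_besselSeries_lt_of_six_le m hm t ht'
  have hG0 : 0 < besselSeries (25 / 2) t := besselSeries_pos (by norm_num) (by positivity)
  have hd0 := dcoef_natCast_nonneg m
  have hd := dcoef_natCast_le m
  have hsqrt := sqrt_mul_add_four_le hm0.le
  have hconst := pi_constant_lt
  have hS : √(π / (25 / 2 * m)) * m = √(2 * π / 25) * √m := by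
    rw [show π / (25 / 2 * (m : ℝ)) = (2 * π / 25) / m by field_simp, Real.sqrt_div (by positivity),
      div_mul_eq_mul_div, div_eq_iff (by positivity), mul_assoc, Real.mul_self_sqrt hm0.le]
  set P : ℝ := (2 * π) ^ (23 / 2 : ℝ)
  set R : ℝ := (2 * (m : ℝ)) ^ (-(1 / 2 : ℝ))
  set G : ℝ := besselSeries (25 / 2) t
  set H : ℝ := besselSeries (23 / 2) (((m : ℝ) + 4) / 4 * t)
  set v : ℝ := √(((m : ℝ) + 4) / 4)
  set w : ℝ := √(2 * π / 25)
  set E : ℝ := (4 / 3) ^ 24 * 5 ^ (m + 1)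
  have hP : 0 < P := by positivity
  have hR : 0 < R := by positivity
  have hv : 0 < v := by positivity
  have hw : 0 < w := by positivity
  have hE : 0 < E := by positivity
  have hsqrt' : √(m : ℝ) ≤ 2 * ((m : ℝ) + 2) * v / (m + 4) := by
    rwa [le_div_iff₀ (by positivity)]
  rw [Cpos]
  calc _ = P * R * ((dcoef m : ℝ) * G) * (√(π / (25 / 2 * m)) * m) *
          ((2 * π ^ 2 / 3) * (2 * m + 3) * (π ^ 4 / 90)) := by
        linear_combination ((2 * π)⁻¹ * (dcoef m : ℝ) * (R * √(π / (25 / 2 * m)) *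
          (2 * π ^ 2 / 3 * m * (2 * m + 3))) * (π ^ 4 / 90)) * h25 +
          (P * R * ((dcoef m : ℝ) * G) * (√(π / (25 / 2 * m)) * m) *
          ((2 * π ^ 2 / 3) * (2 * m + 3) * (π ^ 4 / 90))) * inv_mul_cancel₀ (by positivity : 2 * π ≠ 0)
    _ ≤ P * R * (E * G) * (w * (2 * ((m : ℝ) + 2) * v / (m + 4))) *
          ((2 * π ^ 2 / 3) * (2 * m + 3) * (π ^ 4 / 90)) := by
        rw [hS]
        gcongr
    _ = 2 * π * (m + 2) * P * R * v * (E * (2 * m + 3) / (m + 4) * G) *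
          (w * (2 * π / 3) * (π ^ 4 / 90)) := by ring
    _ ≤ 2 * π * (m + 2) * P * R * v * (E * (2 * m + 3) / (m + 4) * G) * (114 / 100) := by
        gcongr
    _ = 15 / 1000 * (2 * π * (m + 2) * P * R * v * (((m : ℝ) + 4) / 4) ^ 11 *
          (76 * E * (2 * m + 3) * 4 ^ 11 / ((m : ℝ) + 4) ^ 12 * G)) := by
        field_simp
        norm_num
    _ < 15 / 1000 * (2 * π * (m + 2) * P * R * v * (((m : ℝ) + 4) / 4) ^ 11 * H) := by
        gcongr
    _ = _ := by
        linear_combination (-(15 / 1000) * (2 * π * (m + 2) * R)) * h23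

lemma hasSum_one_div_succ_pow_four :
    HasSum (fun γ : ℕ => 1 / (((γ + 1 : ℕ) : ℝ)) ^ 4) (π ^ 4 / 90) := by
  simpa using (hasSum_nat_add_iff' 1).2 hasSum_zeta_four

theorem stmt8 (m : ℕ) (hm : 6 ≤ m) (n ℓ : ℤ) (hn : (m : ℤ) ≤ n)
    (hℓ0 : 0 ≤ ℓ) (hℓm : ℓ ≤ (m : ℤ)) :
    Summable (fun γ : ℕ =>
      (((2 * Real.pi)⁻¹ * (dcoef m : ℝ) *
          ((4 * (m : ℝ)) / ((4 * (m : ℤ) * n - ℓ ^ 2 : ℤ) : ℝ)) ^ ((25 : ℝ) / 4) : ℝ) : ℂ) *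
        tripleTerm m ℓ (4 * (m : ℤ) * n - ℓ ^ 2) (γ + 1)) ∧
    ‖∑' γ : ℕ,
        (((2 * Real.pi)⁻¹ * (dcoef m : ℝ) *
          ((4 * (m : ℝ)) / ((4 * (m : ℤ) * n - ℓ ^ 2 : ℤ) : ℝ)) ^ ((25 : ℝ) / 4) : ℝ) : ℂ) *
        tripleTerm m ℓ (4 * (m : ℤ) * n - ℓ ^ 2) (γ + 1)‖ <
      (15 / 1000) * Cpos m (4 * (m : ℤ) * n - ℓ ^ 2) := by
  set Δ : ℤ := 4 * (m : ℤ) * n - ℓ ^ 2 with hΔ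
  have hm' : (6 : ℤ) ≤ m := by exact_mod_cast hm
  have hΔ' : 3 * (m : ℤ) ^ 2 ≤ Δ := by nlinarith
  have hΔ0 : 0 ≤ Δ := le_trans (by positivity) hΔ'
  set C : ℝ := (2 * Real.pi)⁻¹ * (dcoef m : ℝ) *
    ((4 * (m : ℝ)) / (Δ : ℝ)) ^ ((25 : ℝ) / 4) with hC
  have hC0 : 0 ≤ C := by
    have := dcoef_natCast_nonneg m
    have : (0 : ℝ) ≤ Δ := by exact_mod_cast hΔ0
    positivity
  have hsum := hasSum_one_div_succ_pow_four.mul_left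
    (C * ((2 * (m : ℝ)) ^ (-(1 / 2 : ℝ)) * besselI (25 / 2) (2 * π * √((Δ : ℝ) / m)) *
        √(π / (25 / 2 * m)) * (2 * π ^ 2 / 3 * m * (2 * m + 3))))
  have hbound : ∀ γ : ℕ, ‖(C : ℂ) * tripleTerm m ℓ Δ (γ + 1)‖ ≤
      C * ((2 * (m : ℝ)) ^ (-(1 / 2 : ℝ)) * besselI (25 / 2) (2 * π * √((Δ : ℝ) / m)) *
        √(π / (25 / 2 * m)) * (2 * π ^ 2 / 3 * m * (2 * m + 3))) *
        (1 / (((γ + 1 : ℕ) : ℝ)) ^ 4) := fun γ => by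
    rw [norm_mul, Complex.norm_real, Real.norm_of_nonneg hC0, mul_assoc C]
    exact mul_le_mul_of_nonneg_left
      (norm_tripleTerm_le m (γ + 1) (by omega) γ.succ_pos ℓ Δ hΔ0) hC0
  exact ⟨Summable.of_norm_bounded hsum.summable hbound,
    (tsum_of_norm_bounded hsum hbound).trans_lt (main_bound_lt_Cpos m hm Δ hΔ')⟩
end

section
/- Let m, ñ, k be integers with m ≥ 6, ñ ≥ 1, 1 ≤ k ≤ m and 4mñ − (m−k)² < 0. Then c_m^F(ñ, m−k) ≤ (181/100 + (243/400)·k)·ĉ_m^F(ñ, m−k), where ĉ_m^F(ñ, m−k) = (m − k − 2ñ)·d(k + ñ)·d(ñ). -/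
/-- The polar coefficient `c_m^F(ñ, ℓ̃)`, given by the `SL(2,ℤ)` continued-fraction sum
over quadruples `(p, q, r, s)` with `ps - qr = 1`, `r, s > 0` and
`0 ≤ ℓ̃/(2m) - q/s < 1/(rs)`; only finitely many terms are nonzero. -/
noncomputable def polarCoef (m nt ℓt : ℤ) : ℤ :=
  ∑ᶠ (p : ℤ) (q : ℤ) (r : ℤ) (s : ℤ),
    if p * s - q * r = 1 ∧ 0 < r ∧ 0 < s ∧
        0 ≤ (ℓt : ℚ) / (2 * m) - (q : ℚ) / s ∧
        (ℓt : ℚ) / (2 * m) - (q : ℚ) / s < 1 / ((r : ℚ) * s) then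
      (-2 * r * s * nt - 2 * p * q * m + (p * s + q * r) * ℓt) *
        dcoef (r ^ 2 * nt + p ^ 2 * m - p * r * ℓt) *
        dcoef (s ^ 2 * nt + q ^ 2 * m - q * s * ℓt)
    else 0

/-- Adding a part equal to `1` shows that the partition function is nondecreasing. -/
theorem card_partition_le_succ (n : ℕ) :
    Fintype.card (Nat.Partition n) ≤ Fintype.card (Nat.Partition (n + 1)) := by
  let f : Nat.Partition n → Nat.Partition (n + 1) := fun P =>
    { parts := 1 ::ₘ P.parts
      parts_pos := by
        intro i hi
        rcases Multiset.mem_cons.1 hi with rfl | h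
        · exact one_pos
        · exact P.parts_pos h
      parts_sum := by rw [Multiset.sum_cons, P.parts_sum, add_comm] }
  refine Fintype.card_le_of_injective f fun P Q h => ?_
  have h' : (f P).parts = (f Q).parts := by rw [h]
  exact Nat.Partition.ext ((Multiset.cons_inj_right 1).1 h')

theorem dcoef_nonneg (n : ℤ) : 0 ≤ dcoef n := by
  unfold dcoef
  split_ifs
  · exact Finset.sum_nonneg fun v _ => Finset.prod_nonneg fun i _ => Int.natCast_nonneg _
  · exact le_rfl

theorem dcoef_of_lt {n : ℤ} (h : n ≤ -2) : dcoef n = 0 := by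
  unfold dcoef
  rw [if_neg (by omega)]

theorem dcoef_natCast_sub_one (N : ℕ) :
    dcoef ((N : ℤ) - 1) = ∑ v ∈ Finset.Nat.antidiagonalTuple 24 N,
      ∏ i, (Fintype.card (Nat.Partition (v i)) : ℤ) := by
  unfold dcoef
  rw [if_pos (by omega)]
  congr 2
  omega

/-- Weighting each tuple by one of its entries, raise that entry by one. -/
theorem sum_antidiagonalTuple_weight_le {t : ℕ} (g : ℕ → ℤ) (hg : ∀ n, 0 ≤ g n)
    (hmono : ∀ n, g n ≤ g (n + 1)) (N : ℕ) (i : Fin t) :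
    ∑ v ∈ Finset.Nat.antidiagonalTuple t N, ((v i : ℤ) + 1) * ∏ j, g (v j) ≤
      ∑ v ∈ Finset.Nat.antidiagonalTuple t (N + 1), (v i : ℤ) * ∏ j, g (v j) := by
  let e : (Fin t → ℕ) → (Fin t → ℕ) := fun v => v + Pi.single i 1
  have he : Function.Injective e := add_left_injective _
  have hsub : (Finset.Nat.antidiagonalTuple t N).image e ⊆
      Finset.Nat.antidiagonalTuple t (N + 1) := by
    intro w hw
    obtain ⟨v, hv, rfl⟩ := Finset.mem_image.1 hw
    rw [Finset.Nat.mem_antidiagonalTuple] at hv ⊢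
    simp [e, Finset.sum_add_distrib, hv]
  calc ∑ v ∈ Finset.Nat.antidiagonalTuple t N, ((v i : ℤ) + 1) * ∏ j, g (v j)
      ≤ ∑ v ∈ Finset.Nat.antidiagonalTuple t N, ((e v i : ℕ) : ℤ) * ∏ j, g (e v j) := by
        refine Finset.sum_le_sum fun v _ => ?_
        have h1 : ((e v i : ℕ) : ℤ) = v i + 1 := by simp [e]
        rw [h1]
        refine mul_le_mul_of_nonneg_left ?_ (by positivity)
        refine Finset.prod_le_prod (fun j _ => hg _) fun j _ => ?_
        by_cases hj : j = i
        · subst hj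
          simpa [e] using hmono (v j)
        · simp [e, hj]
    _ = ∑ w ∈ (Finset.Nat.antidiagonalTuple t N).image e, (w i : ℤ) * ∏ j, g (w j) := by
        rw [Finset.sum_image fun x _ y _ h => he h]
    _ ≤ _ := Finset.sum_le_sum_of_subset_of_nonneg hsub fun w _ _ =>
        mul_nonneg (by positivity) (Finset.prod_nonneg fun j _ => hg _)

/-- The growth inequality `(N + 24) d(N - 1) ≤ (N + 1) d(N)`. -/
theorem dcoef_succ_growth {x : ℤ} (hx : -1 ≤ x) :
    (x + 25) * dcoef x ≤ (x + 2) * dcoef (x + 1) := by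
  obtain ⟨N, hN⟩ : ∃ N : ℕ, x = (N : ℤ) - 1 := ⟨(x + 1).toNat, by omega⟩
  have hN' : x + 1 = ((N + 1 : ℕ) : ℤ) - 1 := by push_cast; omega
  rw [hN', hN, dcoef_natCast_sub_one, dcoef_natCast_sub_one]
  set g : ℕ → ℤ := fun n => (Fintype.card (Nat.Partition n) : ℤ) with hgdef
  have key := Finset.sum_le_sum fun (i : Fin 24) (_ : i ∈ Finset.univ) =>
    sum_antidiagonalTuple_weight_le g (fun n => Int.natCast_nonneg _)
      (fun n => Int.ofNat_le.2 (card_partition_le_succ n)) N i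
  rw [Finset.sum_comm, Finset.sum_comm (s := Finset.univ)] at key
  have hl : ∀ v ∈ Finset.Nat.antidiagonalTuple 24 N,
      ∑ i, ((v i : ℤ) + 1) * ∏ j, g (v j) = ((N : ℤ) + 24) * ∏ j, g (v j) := by
    intro v hv
    rw [Finset.Nat.mem_antidiagonalTuple] at hv
    rw [← Finset.sum_mul, Finset.sum_add_distrib, ← Nat.cast_sum, hv]
    simp
  have hr : ∀ v ∈ Finset.Nat.antidiagonalTuple 24 (N + 1),
      ∑ i, (v i : ℤ) * ∏ j, g (v j) = ((N : ℤ) + 1) * ∏ j, g (v j) := by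
    intro v hv
    rw [Finset.Nat.mem_antidiagonalTuple] at hv
    rw [← Finset.sum_mul, ← Nat.cast_sum, hv]
    simp
  rw [Finset.sum_congr rfl hl, Finset.sum_congr rfl hr, ← Finset.mul_sum, ← Finset.mul_sum] at key
  rwa [show (N : ℤ) - 1 + 25 = N + 24 by ring, show (N : ℤ) - 1 + 2 = N + 1 by ring]

theorem dcoef_growth {x y : ℤ} (hxy : x ≤ y) (hy : -1 ≤ y) :
    (y + 1 + 23 * (y - x)) * dcoef x ≤ (y + 1) * dcoef y := by
  rcases lt_or_ge x (-1) with hx | hx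
  · rw [dcoef_of_lt (by omega), mul_zero]
    exact mul_nonneg (by omega) (dcoef_nonneg y)
  induction y, hxy using Int.leInduction with
  | base => simp
  | succ y hxy ih =>
    have ih := ih (by omega)
    have step := dcoef_succ_growth (x := y) (by omega)
    have h0 := dcoef_nonneg x
    rcases eq_or_lt_of_le (show -1 ≤ y by omega) with h | h
    · obtain rfl : x = y := by omega
      linarith
    · have hy : 0 < y + 1 := by omega
      refine le_of_mul_le_mul_left ?_ hy
      nlinarith [mul_le_mul_of_nonneg_left step hy.le,
        mul_le_mul_of_nonneg_left ih (show 0 ≤ y + 25 by omega),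
        mul_nonneg h0 (show 0 ≤ y - x by omega)]

theorem dcoef_mono {x y : ℤ} (hxy : x ≤ y) : dcoef x ≤ dcoef y := by
  rcases lt_or_ge x (-1) with hx | hx
  · rw [dcoef_of_lt (by omega)]
    exact dcoef_nonneg y
  induction y, hxy using Int.leInduction with
  | base => exact le_rfl
  | succ y hxy ih =>
    refine ih.trans (le_of_mul_le_mul_left ?_ (show 0 < y + 2 by omega))
    nlinarith [dcoef_succ_growth (x := y) (by omega), dcoef_nonneg y]

/-- `d(x) / (x + 1)` is nondecreasing for `x ≥ 0`. -/
theorem dcoef_div_mono {x y : ℤ} (hxy : x ≤ y) (hx : 0 ≤ x) :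
    (y + 1) * dcoef x ≤ (x + 1) * dcoef y := by
  induction y, hxy using Int.leInduction with
  | base => exact le_rfl
  | succ y hxy ih =>
    have step := dcoef_succ_growth (x := y) (by omega)
    refine le_of_mul_le_mul_left ?_ (show 0 < y + 2 by omega)
    nlinarith [mul_le_mul_of_nonneg_left step (show 0 ≤ x + 1 by omega),
      mul_le_mul_of_nonneg_left ih (show 0 ≤ y + 25 by omega),
      mul_nonneg (dcoef_nonneg x) (show 0 ≤ y by omega), dcoef_nonneg x]

/-- Sequences of binary quadratic forms `a x² - L x y + b y²` with `L > 0` in which each step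
replaces one of the two outer coefficients by the value `a + b - L` at the mediant `(1, 1)`. -/
structure IsMediantDescent (a b L : ℕ → ℤ) : Prop where
  pos : ∀ i, 0 < L i
  step : ∀ i,
    (a (i + 1) = a i + b i - L i ∧ b (i + 1) = b i ∧ L (i + 1) = L i - 2 * b i) ∨
    (b (i + 1) = a i + b i - L i ∧ a (i + 1) = a i ∧ L (i + 1) = L i - 2 * a i)

namespace IsMediantDescent

variable {a b L : ℕ → ℤ}

theorem swap (h : IsMediantDescent a b L) : IsMediantDescent b a L where
  pos := h.pos
  step i := by
    have := h.step i
    rw [add_comm (b i)]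
    tauto

theorem shift (h : IsMediantDescent a b L) :
    IsMediantDescent (fun i => a (i + 1)) (fun i => b (i + 1)) (fun i => L (i + 1)) where
  pos i := h.pos (i + 1)
  step i := h.step (i + 1)

theorem add_le (h : IsMediantDescent a b L) (i : ℕ) : a i + b i ≤ a 0 + b 0 - i := by
  induction i with
  | zero => simp
  | succ i ih =>
    have h0 := h.pos i
    have h1 := h.pos (i + 1)
    push_cast
    rcases h.step i with h | h <;> omega

theorem le_neg_two (h : IsMediantDescent a b L) (h0 : a 0 ≤ -2 ∨ b 0 ≤ -2) (i : ℕ) :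
    a i ≤ -2 ∨ b i ≤ -2 := by
  induction i with
  | zero => exact h0
  | succ i ih =>
    have h0 := h.pos i
    have h1 := h.pos (i + 1)
    rcases h.step i with h | h <;> omega

theorem sum_eq_zero (h : IsMediantDescent a b L) (h0 : a 0 ≤ -2 ∨ b 0 ≤ -2) (N : ℕ) :
    ∑ i ∈ Finset.range N, L i * dcoef (a i) * dcoef (b i) = 0 := by
  refine Finset.sum_eq_zero fun i _ => ?_
  rcases h.le_neg_two h0 i with h | h <;> simp [dcoef_of_lt h]

theorem sum_le_of_eq_neg_one (N : ℕ) : ∀ {a b L : ℕ → ℤ}, IsMediantDescent a b L →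
    a 0 = -1 → -1 ≤ b 0 →
    16 * ∑ i ∈ Finset.range N, L i * dcoef (a i) * dcoef (b i) ≤
      (16 * L 0 + b 0 + 1) * dcoef (a 0) * dcoef (b 0) := by
  induction N with
  | zero =>
    intro a b L h ha hb
    have := h.pos 0
    simpa using mul_nonneg (mul_nonneg (show 0 ≤ 16 * L 0 + b 0 + 1 by omega)
      (dcoef_nonneg (a 0))) (dcoef_nonneg (b 0))
  | succ N ih =>
    intro a b L h ha hb
    have hL0 := h.pos 0
    have hL1 := h.pos 1
    have hd := dcoef_nonneg (a 0)
    have hdb := dcoef_nonneg (b 0)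
    rw [Finset.sum_range_succ']
    have hzero : (a 1 ≤ -2 ∨ b 1 ≤ -2) →
        16 * (∑ i ∈ Finset.range N, L (i + 1) * dcoef (a (i + 1)) * dcoef (b (i + 1)) +
          L 0 * dcoef (a 0) * dcoef (b 0)) ≤
        (16 * L 0 + b 0 + 1) * dcoef (a 0) * dcoef (b 0) := by
      intro h'
      rw [h.shift.sum_eq_zero h']
      nlinarith [mul_nonneg (mul_nonneg (show 0 ≤ b 0 + 1 by omega) hd) hdb]
    rcases h.step 0 with ⟨h1, h2, h3⟩ | ⟨h1, h2, h3⟩ <;> rw [zero_add] at h1 h2 h3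
    · exact hzero (by omega)
    · by_cases hb1 : b 1 ≤ -2
      · exact hzero (Or.inr hb1)
      have key := ih h.shift (show a 1 = -1 by omega) (show -1 ≤ b 1 by omega)
      simp only [zero_add] at key
      have growth := dcoef_growth (x := b 1) (y := b 0) (by omega) hb
      have hd1 := dcoef_nonneg (b 1)
      have hmain : (16 * L 1 + b 1 + 1) * dcoef (b 1) ≤ (b 0 + 1) * dcoef (b 0) :=
        (mul_le_mul_of_nonneg_right (by omega) hd1).trans growth
      rw [h2] at key
      nlinarith [mul_le_mul_of_nonneg_left hmain hd]

theorem sum_le (N : ℕ) : ∀ {a b L : ℕ → ℤ}, IsMediantDescent a b L → -1 ≤ a 0 → -1 ≤ b 0 →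
    16 * ∑ i ∈ Finset.range N, L i * dcoef (a i) * dcoef (b i) ≤
      L 0 * (17 + max (a 0) (b 0)) * dcoef (a 0) * dcoef (b 0) := by
  induction N with
  | zero =>
    intro a b L h ha hb
    have := h.pos 0
    simpa using mul_nonneg (mul_nonneg (mul_nonneg this.le
      (show 0 ≤ 17 + max (a 0) (b 0) by omega)) (dcoef_nonneg (a 0))) (dcoef_nonneg (b 0))
  | succ N ih =>
    -- By symmetry only the steps replacing `a` have to be treated.
    have main : ∀ {a b L : ℕ → ℤ}, IsMediantDescent a b L → 0 ≤ a 0 → 0 ≤ b 0 →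
        a 1 = a 0 + b 0 - L 0 → b 1 = b 0 → L 1 = L 0 - 2 * b 0 →
        16 * ∑ i ∈ Finset.range (N + 1), L i * dcoef (a i) * dcoef (b i) ≤
          L 0 * (17 + max (a 0) (b 0)) * dcoef (a 0) * dcoef (b 0) := by
      intro a b L h ha hb h1 h2 h3
      have hL0 := h.pos 0
      have hL1 := h.pos 1
      have hda := dcoef_nonneg (a 0)
      have hdb := dcoef_nonneg (b 0)
      have hda1 := dcoef_nonneg (a 1)
      suffices hs : 16 * ∑ i ∈ Finset.range N,
          L (i + 1) * dcoef (a (i + 1)) * dcoef (b (i + 1)) ≤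
            L 0 * (1 + max (a 0) (b 0)) * dcoef (a 0) * dcoef (b 0) by
        rw [Finset.sum_range_succ']
        linarith
      by_cases ha1 : a 1 ≤ -2
      · rw [h.shift.sum_eq_zero (Or.inl ha1), mul_zero]
        exact mul_nonneg (mul_nonneg (mul_nonneg hL0.le (by omega)) hda) hdb
      have key := ih h.shift (show -1 ≤ a 1 by omega) (show -1 ≤ b 1 by omega)
      simp only [zero_add] at key
      have growth := dcoef_growth (x := a 1) (y := a 0) (by omega) (by omega)
      have hmax : max (a 0) (b 0) = a 0 := by omega
      rw [hmax]
      have hmain : (17 + max (a 1) (b 1)) * dcoef (a 1) ≤ (1 + a 0) * dcoef (a 0) := by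
        rw [add_comm 1]
        exact (mul_le_mul_of_nonneg_right (by omega) hda1).trans growth
      calc _ ≤ L 1 * (17 + max (a 1) (b 1)) * dcoef (a 1) * dcoef (b 1) := key
        _ = (L 1 * ((17 + max (a 1) (b 1)) * dcoef (a 1))) * dcoef (b 0) := by rw [h2]; ring
        _ ≤ (L 0 * ((1 + a 0) * dcoef (a 0))) * dcoef (b 0) := by
          refine mul_le_mul_of_nonneg_right ?_ hdb
          exact mul_le_mul (by omega) hmain (mul_nonneg (by omega) hda1) hL0.le
        _ = _ := by ring
    have edge : ∀ {a b L : ℕ → ℤ}, IsMediantDescent a b L → a 0 = -1 → -1 ≤ b 0 →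
        16 * ∑ i ∈ Finset.range (N + 1), L i * dcoef (a i) * dcoef (b i) ≤
          L 0 * (17 + max (a 0) (b 0)) * dcoef (a 0) * dcoef (b 0) := by
      intro a b L h ha hb
      refine (sum_le_of_eq_neg_one (N + 1) h ha hb).trans ?_
      have hL0 := h.pos 0
      have hmax : max (a 0) (b 0) = b 0 := by omega
      rw [hmax]
      refine mul_le_mul_of_nonneg_right (mul_le_mul_of_nonneg_right ?_ (dcoef_nonneg _))
        (dcoef_nonneg _)
      nlinarith [mul_nonneg (show 0 ≤ L 0 - 1 by omega) (show 0 ≤ b 0 + 1 by omega)]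
    have comm : ∀ {a b L : ℕ → ℤ},
        (16 * ∑ i ∈ Finset.range (N + 1), L i * dcoef (b i) * dcoef (a i) ≤
          L 0 * (17 + max (b 0) (a 0)) * dcoef (b 0) * dcoef (a 0)) →
        16 * ∑ i ∈ Finset.range (N + 1), L i * dcoef (a i) * dcoef (b i) ≤
          L 0 * (17 + max (a 0) (b 0)) * dcoef (a 0) * dcoef (b 0) := by
      intro a b L h
      simpa only [mul_right_comm _ (dcoef (b _)), max_comm (b 0)] using h
    intro a b L h ha hb
    rcases eq_or_lt_of_le ha with ha' | ha'
    · exact edge h ha'.symm hb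
    rcases eq_or_lt_of_le hb with hb' | hb'
    · exact comm (edge h.swap hb'.symm ha)
    rcases h.step 0 with ⟨h1, h2, h3⟩ | ⟨h1, h2, h3⟩
    · exact main h (by omega) (by omega) h1 h2 h3
    · exact comm (main h.swap (by omega) (by omega) (by rw [h1, add_comm (a 0)]) h2 h3)

end IsMediantDescent

/-- One step of the Stern–Brocot descent towards `ℓ / (2m)`: the interval `[q/s, p/r]`, encoded
as `(p, q, r, s)`, is cut at its mediant. -/
def fareyStep (m ℓ : ℤ) : ℤ × ℤ × ℤ × ℤ → ℤ × ℤ × ℤ × ℤ := fun ⟨p, q, r, s⟩ =>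
  if ℓ * (r + s) < 2 * m * (p + q) then (p + q, q, r + s, s) else (p, p + q, r, r + s)

/-- The descent started from `[0/1, 1/1]`. -/
def fareySeq (m ℓ : ℤ) (i : ℕ) : ℤ × ℤ × ℤ × ℤ := (fareyStep m ℓ)^[i] (1, 0, 1, 1)

/-- `[q/s, p/r]` is a Farey interval containing `ℓ / (2m)` and different from its right end. -/
def IsFareyInterval (m ℓ : ℤ) : ℤ × ℤ × ℤ × ℤ → Prop := fun ⟨p, q, r, s⟩ =>
  p * s - q * r = 1 ∧ 0 < r ∧ 0 < s ∧ 2 * m * q ≤ ℓ * s ∧ ℓ * r < 2 * m * p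

theorem fareySeq_succ (m ℓ : ℤ) (i : ℕ) :
    fareySeq m ℓ (i + 1) = fareyStep m ℓ (fareySeq m ℓ i) :=
  Function.iterate_succ_apply' _ _ _

theorem isFareyInterval_fareySeq {m ℓ : ℤ} (hℓ : 0 ≤ ℓ) (hℓm : ℓ < m) (i : ℕ) :
    IsFareyInterval m ℓ (fareySeq m ℓ i) := by
  induction i with
  | zero =>
    simp only [fareySeq, Function.iterate_zero, id, IsFareyInterval]
    omega
  | succ i ih =>
    rw [fareySeq_succ]
    generalize fareySeq m ℓ i = x at ih ⊢
    obtain ⟨p, q, r, s⟩ := x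
    obtain ⟨h1, h2, h3, h4, h5⟩ := ih
    simp only [fareyStep]
    split_ifs with h
    · exact ⟨by linarith, by omega, h3, h4, h⟩
    · exact ⟨by linarith, h2, by omega, not_lt.1 h, h5⟩

/-- Every Farey interval around `ℓ / (2m)` occurs in the descent. -/
theorem exists_fareySeq_eq {m ℓ : ℤ} (hℓ : 0 ≤ ℓ) (hℓm : ℓ < m) (t : ℕ) :
    ∀ {p q r s : ℤ}, IsFareyInterval m ℓ (p, q, r, s) → r + s ≤ t →
      ∃ i, fareySeq m ℓ i = (p, q, r, s) := by
  induction t with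
  | zero =>
    rintro p q r s ⟨-, h2, h3, -⟩ ht
    push_cast at ht
    omega
  | succ t ih =>
    rintro p q r s ⟨h1, h2, h3, h4, h5⟩ ht
    push_cast at ht
    rcases lt_trichotomy r s with hrs | rfl | hrs
    · obtain ⟨i, hi⟩ := ih (p := p) (q := q - p) (r := r) (s := s - r)
        ⟨by linarith, h2, by omega, by linarith, h5⟩ (by omega)
      refine ⟨i + 1, ?_⟩
      rw [fareySeq_succ, hi]
      simp only [fareyStep]
      rw [if_neg (by simpa using h4)]
      simp
    · have hr : r = 1 := by
        have hdvd : r ∣ 1 := ⟨p - q, by linarith⟩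
        exact Int.eq_one_of_dvd_one h2.le hdvd
      subst hr
      have hp : 0 < p := by nlinarith
      have hq : q ≤ 0 := by
        by_contra hq
        nlinarith
      refine ⟨0, ?_⟩
      obtain rfl : p = 1 := by omega
      obtain rfl : q = 0 := by omega
      rfl
    · obtain ⟨i, hi⟩ := ih (p := p - q) (q := q) (r := r - s) (s := s)
        ⟨by linarith, by omega, h3, h4, by linarith⟩ (by omega)
      refine ⟨i + 1, ?_⟩
      rw [fareySeq_succ, hi]
      simp only [fareyStep]
      rw [if_pos (by simpa using h5)]
      simp

/-- The value `Q(r, p)` at the right end of the interval, for `Q(x, y) = n x² - ℓ x y + m y²`. -/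
def rightValue (m n ℓ : ℤ) : ℤ × ℤ × ℤ × ℤ → ℤ := fun ⟨p, _, r, _⟩ =>
  r ^ 2 * n + p ^ 2 * m - p * r * ℓ

/-- The value `Q(s, q)` at the left end of the interval, for `Q(x, y) = n x² - ℓ x y + m y²`. -/
def leftValue (m n ℓ : ℤ) : ℤ × ℤ × ℤ × ℤ → ℤ := fun ⟨_, q, _, s⟩ =>
  s ^ 2 * n + q ^ 2 * m - q * s * ℓ

/-- The negative of the polarization of `Q(x, y) = n x² - ℓ x y + m y²` at the two ends. -/
def crossValue (m n ℓ : ℤ) : ℤ × ℤ × ℤ × ℤ → ℤ := fun ⟨p, q, r, s⟩ =>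
  -2 * r * s * n - 2 * p * q * m + (p * s + q * r) * ℓ

theorem crossValue_pos {m n ℓ : ℤ} (hm : 0 < m) (hΔ : 4 * m * n < ℓ ^ 2)
    {x : ℤ × ℤ × ℤ × ℤ} (hx : IsFareyInterval m ℓ x) : 0 < crossValue m n ℓ x := by
  obtain ⟨p, q, r, s⟩ := x
  obtain ⟨-, h2, h3, h4, h5⟩ := hx
  have hid : 2 * m * crossValue m n ℓ (p, q, r, s) =
      (2 * m * p - ℓ * r) * (ℓ * s - 2 * m * q) + (ℓ ^ 2 - 4 * m * n) * (r * s) := by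
    simp only [crossValue]
    ring
  have h6 : 0 ≤ (2 * m * p - ℓ * r) * (ℓ * s - 2 * m * q) :=
    mul_nonneg (by linarith) (by linarith)
  have h7 : 0 < (ℓ ^ 2 - 4 * m * n) * (r * s) := mul_pos (by linarith) (mul_pos h2 h3)
  refine pos_of_mul_pos_right (a := 2 * m) ?_ (by linarith)
  linarith

theorem isMediantDescent_fareySeq {m n ℓ : ℤ} (hℓ : 0 ≤ ℓ) (hℓm : ℓ < m)
    (hΔ : 4 * m * n < ℓ ^ 2) :
    IsMediantDescent (fun i => rightValue m n ℓ (fareySeq m ℓ i))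
      (fun i => leftValue m n ℓ (fareySeq m ℓ i))
      (fun i => crossValue m n ℓ (fareySeq m ℓ i)) where
  pos i := crossValue_pos (by omega) hΔ (isFareyInterval_fareySeq hℓ hℓm i)
  step i := by
    rw [fareySeq_succ]
    generalize fareySeq m ℓ i = x
    obtain ⟨p, q, r, s⟩ := x
    simp only [fareyStep]
    split_ifs with h
    · left
      refine ⟨?_, rfl, ?_⟩ <;> simp only [rightValue, leftValue, crossValue] <;> ring
    · right
      refine ⟨?_, rfl, ?_⟩ <;> simp only [rightValue, leftValue, crossValue] <;> ring

theorem fareySeq_injective {m ℓ : ℤ} (hℓ : 0 ≤ ℓ) (hℓm : ℓ < m) :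
    Function.Injective (fareySeq m ℓ) := by
  have hmono : StrictMono fun i => (fareySeq m ℓ i).2.2.1 + (fareySeq m ℓ i).2.2.2 := by
    refine strictMono_nat_of_lt_succ fun i => ?_
    have hi := isFareyInterval_fareySeq hℓ hℓm i
    rw [fareySeq_succ]
    generalize fareySeq m ℓ i = x at hi ⊢
    obtain ⟨p, q, r, s⟩ := x
    obtain ⟨-, h2, h3, -⟩ := hi
    simp only [fareyStep]
    split_ifs <;> simp only <;> omega
  intro i j hij
  exact hmono.injective (by simp only [hij])

theorem isFareyInterval_iff {m ℓ p q r s : ℤ} (hm : 0 < m) :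
    (p * s - q * r = 1 ∧ 0 < r ∧ 0 < s ∧
        0 ≤ (ℓ : ℚ) / (2 * m) - (q : ℚ) / s ∧
        (ℓ : ℚ) / (2 * m) - (q : ℚ) / s < 1 / ((r : ℚ) * s)) ↔
      IsFareyInterval m ℓ (p, q, r, s) := by
  simp only [IsFareyInterval]
  refine and_congr_right fun hdet => and_congr_right fun hr => and_congr_right fun hs => ?_
  have hm' : (0 : ℚ) < 2 * m := by exact_mod_cast (by omega : 0 < 2 * m)
  have hr' : (0 : ℚ) < r := by exact_mod_cast hr
  have hs' : (0 : ℚ) < s := by exact_mod_cast hs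
  have hdet' : (p : ℚ) * s - q * r = 1 := by exact_mod_cast hdet
  have hright : (1 : ℚ) / (r * s) = p / r - q / s := by
    rw [← hdet']
    field_simp
  refine and_congr ?_ ?_
  · rw [sub_nonneg, div_le_div_iff₀ hs' hm', mul_comm (q : ℚ)]
    exact_mod_cast Iff.rfl
  · rw [hright, sub_lt_sub_iff_right, div_lt_div_iff₀ hm' hr', mul_comm (p : ℚ)]
    exact_mod_cast Iff.rfl

/-- The polar coefficient is the sum over the Stern–Brocot descent. -/
theorem polarCoef_eq_sum {m n ℓ : ℤ} (hℓ : 0 ≤ ℓ) (hℓm : ℓ < m) (hΔ : 4 * m * n < ℓ ^ 2)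
    {N : ℕ} (hN : 2 * n + m - ℓ + 3 ≤ N) :
    polarCoef m n ℓ = ∑ i ∈ Finset.range N, crossValue m n ℓ (fareySeq m ℓ i) *
      dcoef (rightValue m n ℓ (fareySeq m ℓ i)) *
      dcoef (leftValue m n ℓ (fareySeq m ℓ i)) := by
  classical
  let F : ℤ × ℤ × ℤ × ℤ → ℤ := fun x => if IsFareyInterval m ℓ x then
    crossValue m n ℓ x * dcoef (rightValue m n ℓ x) * dcoef (leftValue m n ℓ x) else 0
  have hF : polarCoef m n ℓ = ∑ᶠ (p : ℤ) (q : ℤ) (r : ℤ) (s : ℤ), F (p, q, r, s) := by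
    unfold polarCoef
    refine finsum_congr fun p => finsum_congr fun q => finsum_congr fun r =>
      finsum_congr fun s => ?_
    simp only [isFareyInterval_iff (show 0 < m by omega)]
    rfl
  have hsupp : Function.support F ⊆ ((Finset.range N).image (fareySeq m ℓ) : Finset _) := by
    rintro ⟨p, q, r, s⟩ hx
    have hx : F (p, q, r, s) ≠ 0 := hx
    have hI : IsFareyInterval m ℓ (p, q, r, s) := by
      by_contra h
      exact hx (if_neg h)
    obtain ⟨i, hi⟩ := exists_fareySeq_eq hℓ hℓm (r + s).toNat hI (by omega)
    refine Finset.mem_coe.2 (Finset.mem_image.2 ⟨i, Finset.mem_range.2 ?_, hi⟩)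
    by_contra hiN
    have hle := (isMediantDescent_fareySeq hℓ hℓm hΔ).add_le i
    have h0 : rightValue m n ℓ (fareySeq m ℓ 0) + leftValue m n ℓ (fareySeq m ℓ 0) =
        2 * n + m - ℓ := by
      simp only [fareySeq, Function.iterate_zero, id, rightValue, leftValue]
      ring
    simp only [h0, hi] at hle
    refine hx ((if_pos hI).trans ?_)
    rcases (show rightValue m n ℓ (p, q, r, s) ≤ -2 ∨ leftValue m n ℓ (p, q, r, s) ≤ -2 by
      omega) with h | h <;> simp [dcoef_of_lt h]
  have hfin : (Function.support F).Finite := (Finset.finite_toSet _).subset hsupp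
  have hinner : ∀ p : ℤ, (Function.support fun x : ℤ × ℤ × ℤ => F (p, x)).Finite := fun p =>
    hfin.preimage (f := fun x : ℤ × ℤ × ℤ => (p, x)) fun _ _ _ _ h => (Prod.mk.inj h).2
  have hcurry : ∑ᶠ (p : ℤ) (q : ℤ) (r : ℤ) (s : ℤ), F (p, q, r, s) = ∑ᶠ x, F x := by
    rw [finsum_curry F hfin]
    exact finsum_congr fun p => (finsum_curry₃ (fun x => F (p, x)) (hinner p)).symm
  rw [hF, hcurry, finsum_eq_sum_of_support_subset F hsupp,
    Finset.sum_image fun i _ j _ h => fareySeq_injective hℓ hℓm h]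
  exact Finset.sum_congr rfl fun i _ => if_pos (isFareyInterval_fareySeq hℓ hℓm i)

theorem stmt10 (m nt k : ℤ) (hm : 6 ≤ m) (hnt : 1 ≤ nt) (hk1 : 1 ≤ k) (hkm : k ≤ m)
    (hΔt : 4 * m * nt - (m - k) ^ 2 < 0) :
    (polarCoef m nt (m - k) : ℝ) ≤
      (181 / 100 + (243 / 400) * (k : ℝ)) *
        (((m - k - 2 * nt) * dcoef (k + nt) * dcoef nt : ℤ) : ℝ) := by
  have hℓ : 0 ≤ m - k := by omega
  have hℓm : m - k < m := by omega
  have hΔ : 4 * m * nt < (m - k) ^ 2 := by linarith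
  have h4 : 4 * nt < m - k := by
    by_contra h
    nlinarith
  have hdesc := isMediantDescent_fareySeq hℓ hℓm hΔ
  have hsum := polarCoef_eq_sum hℓ hℓm hΔ
    (N := (2 * nt + m - (m - k) + 3).toNat + 1) (by push_cast; omega)
  rw [Finset.sum_range_succ'] at hsum
  have hseq0 : fareySeq m (m - k) 0 = (1, 0, 1, 1) := rfl
  have hseq1 : fareySeq m (m - k) 1 = (1, 0, 2, 1) := by
    rw [fareySeq_succ, hseq0]
    simp only [fareyStep]
    rw [if_pos (by omega)]
    rfl
  have htail : 400 * ∑ i ∈ Finset.range (2 * nt + m - (m - k) + 3).toNat,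
      crossValue m nt (m - k) (fareySeq m (m - k) (i + 1)) *
        dcoef (rightValue m nt (m - k) (fareySeq m (m - k) (i + 1))) *
        dcoef (leftValue m nt (m - k) (fareySeq m (m - k) (i + 1))) ≤
      (324 + 243 * k) * ((m - k - 2 * nt) * dcoef (k + nt) * dcoef nt) := by
    have hd := dcoef_nonneg nt
    have hdk := dcoef_nonneg (k + nt)
    have hright : rightValue m nt (m - k) (fareySeq m (m - k) 1) = 4 * nt + 2 * k - m := by
      rw [hseq1]
      simp only [rightValue]
      ring
    have hleft : leftValue m nt (m - k) (fareySeq m (m - k) 1) = nt := by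
      rw [hseq1]
      simp only [leftValue]
      ring
    have hcross : crossValue m nt (m - k) (fareySeq m (m - k) 1) = m - k - 4 * nt := by
      rw [hseq1]
      simp only [crossValue]
      ring
    set a := 4 * nt + 2 * k - m with ha
    by_cases ha1 : a ≤ -2
    · rw [hdesc.shift.sum_eq_zero (Or.inl (by simpa only [zero_add, hright] using ha1)), mul_zero]
      exact mul_nonneg (by omega) (mul_nonneg (mul_nonneg (by omega) hdk) hd)
    have key := IsMediantDescent.sum_le (2 * nt + m - (m - k) + 3).toNat hdesc.shift
      (by simp only [zero_add, hright]; omega) (by simp only [zero_add, hleft]; omega)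
    simp only [zero_add, hright, hleft, hcross] at key
    have hda := dcoef_nonneg a
    have hmain : 25 * ((17 + max a nt) * dcoef a) ≤ (324 + 243 * k) * dcoef (k + nt) := by
      rcases le_total nt a with h | h
      · rw [max_eq_left h]
        have hmono := dcoef_mono (show a ≤ k + nt by omega)
        nlinarith [mul_le_mul_of_nonneg_right (show 25 * (17 + a) ≤ 324 + 243 * k by omega) hda]
      · rw [max_eq_right h]
        have hmono := dcoef_mono (show a ≤ k - 1 by omega)
        have hdiv := dcoef_div_mono (show k - 1 ≤ k + nt by omega) (by omega)
        have hd1 := dcoef_nonneg (k - 1)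
        refine le_of_mul_le_mul_left ?_ (show 0 < k + nt + 1 by omega)
        calc (k + nt + 1) * (25 * ((17 + nt) * dcoef a))
            = 25 * (17 + nt) * ((k + nt + 1) * dcoef a) := by ring
          _ ≤ 25 * (17 + nt) * (k * dcoef (k + nt)) := by
            refine mul_le_mul_of_nonneg_left ?_ (by omega)
            nlinarith
          _ = (25 * (17 + nt) * k) * dcoef (k + nt) := by ring
          _ ≤ ((k + nt + 1) * (324 + 243 * k)) * dcoef (k + nt) := by
            refine mul_le_mul_of_nonneg_right ?_ hdk
            nlinarith [mul_nonneg (show 0 ≤ nt - 1 by omega) (show 0 ≤ k - 1 by omega),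
              mul_self_nonneg (k - 1)]
          _ = _ := by ring
    calc _ ≤ 25 * ((m - k - 4 * nt) * (17 + max a nt) * dcoef a * dcoef nt) := by linarith
      _ = ((m - k - 4 * nt) * (25 * ((17 + max a nt) * dcoef a))) * dcoef nt := by ring
      _ ≤ ((m - k - 2 * nt) * ((324 + 243 * k) * dcoef (k + nt))) * dcoef nt := by
        refine mul_le_mul_of_nonneg_right ?_ hd
        exact mul_le_mul (by omega) hmain
          (mul_nonneg (by norm_num) (mul_nonneg (by omega) hda)) (by omega)
      _ = _ := by ring
  have hroot : crossValue m nt (m - k) (fareySeq m (m - k) 0) *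
        dcoef (rightValue m nt (m - k) (fareySeq m (m - k) 0)) *
        dcoef (leftValue m nt (m - k) (fareySeq m (m - k) 0)) =
      (m - k - 2 * nt) * dcoef (k + nt) * dcoef nt := by
    rw [hseq0]
    simp only [crossValue, rightValue, leftValue]
    ring_nf
  rw [hroot] at hsum
  have hscaled : 400 * polarCoef m nt (m - k) ≤
      (724 + 243 * k) * ((m - k - 2 * nt) * dcoef (k + nt) * dcoef nt) := by
    rw [hsum]
    linarith
  have hreal : (400 : ℝ) * (polarCoef m nt (m - k) : ℝ) ≤ (724 + 243 * (k : ℝ)) *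
      (((m - k - 2 * nt) * dcoef (k + nt) * dcoef nt : ℤ) : ℝ) := by
    exact_mod_cast hscaled
  linarith
end
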